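/- arXiv:1501.04814 — 2 statements merged into one kernel-verified Lean document; each statement's English description precedes it below -/
import Mathlib

section
/- Graf–Luschgy theorem for self-similar measures: Let (S_i)_{i=1}^N be contractive similitudes on ℝ^q with contraction ratios (s_i)_{i=1}^N satisfying the open set condition, let (p_i)_{i=1}^N be a probability vector with p_i > 0 for all i, and let P be the unique Borel probability measure with P = Σ_{i=1}^N p_i P ∘ S_i^{−1}. For r ∈ (0,∞) let k_r be the unique positive real number with Σ_{i=1}^N (p_i s_i^r)^{k_r/(k_r+r)} = 1. Then 0 < Q̲_r^{k_r}(P) ≤ Q̄_r^{k_r}(P) < ∞; in particular the quantization dimension D_r(P) exists and equals k_r. -/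
open MeasureTheory Filter Metric
open scoped ENNReal NNReal

/-- The `n`-th quantization error of order `r` for a measure `P`:
`e_{n,r}(P) = inf { (∫ d(x,α)^r dP)^{1/r} : α ⊆ E, 1 ≤ card α ≤ n }`. -/
noncomputable def quantError {E : Type*} [MetricSpace E] [MeasurableSpace E]
    (P : Measure E) (r : ℝ) (n : ℕ) : ℝ :=
  sInf {e : ℝ | ∃ α : Finset E, 1 ≤ α.card ∧ α.card ≤ n ∧
    e = (∫ x, infDist x (↑α : Set E) ^ r ∂P) ^ (1 / r)}

/-- The upper quantization dimension of order `r`. -/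
noncomputable def upperQuantDim {E : Type*} [MetricSpace E] [MeasurableSpace E]
    (P : Measure E) (r : ℝ) : ℝ :=
  limsup (fun n : ℕ => Real.log n / (- Real.log (quantError P r n))) atTop

/-- The lower quantization dimension of order `r`. -/
noncomputable def lowerQuantDim {E : Type*} [MetricSpace E] [MeasurableSpace E]
    (P : Measure E) (r : ℝ) : ℝ :=
  liminf (fun n : ℕ => Real.log n / (- Real.log (quantError P r n))) atTop

/-- The `s`-dimensional upper quantization coefficient of order `r`. -/
noncomputable def upperQuantCoeff {E : Type*} [MetricSpace E] [MeasurableSpace E]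
    (P : Measure E) (r s : ℝ) : ℝ≥0∞ :=
  limsup (fun n : ℕ => ENNReal.ofReal ((n : ℝ) ^ (1 / s) * quantError P r n)) atTop

/-- The `s`-dimensional lower quantization coefficient of order `r`. -/
noncomputable def lowerQuantCoeff {E : Type*} [MetricSpace E] [MeasurableSpace E]
    (P : Measure E) (r s : ℝ) : ℝ≥0∞ :=
  liminf (fun n : ℕ => ENNReal.ofReal ((n : ℝ) ^ (1 / s) * quantError P r n)) atTop


namespace GrafLus

/-- composition of the maps along a word -/
def Sw {E : Type*} {N : ℕ} (S : Fin N → E → E) : List (Fin N) → E → E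
  | [] => id
  | i :: w => fun x => S i (Sw S w x)

/-- multiplicative weight of a word -/
def wt {N : ℕ} (c : Fin N → ℝ) (w : List (Fin N)) : ℝ := (w.map c).prod

/-- two words which differ at some common position -/
def Dv {N : ℕ} (a b : List (Fin N)) : Prop :=
  ∃ u i j v w, i ≠ j ∧ a = u ++ i :: v ∧ b = u ++ j :: w

/-- finite maximal antichains -/
inductive IsCut {N : ℕ} : Finset (List (Fin N)) → Prop
  | nil : IsCut {[]}
  | node (G : Fin N → Finset (List (Fin N))) (h : ∀ i, IsCut (G i)) :
      IsCut (Finset.univ.biUnion fun i => (G i).image (List.cons i))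

section words
variable {E : Type*} {N : ℕ} (S : Fin N → E → E) (c : Fin N → ℝ)

@[simp] lemma wt_nil : wt c [] = 1 := by simp [wt]
@[simp] lemma wt_cons (i : Fin N) (w : List (Fin N)) : wt c (i :: w) = c i * wt c w := by simp [wt]
lemma wt_append (u w : List (Fin N)) : wt c (u ++ w) = wt c u * wt c w := by simp [wt]

lemma wt_pos (hc : ∀ i, 0 < c i) (w : List (Fin N)) : 0 < wt c w := by
  induction w with
  | nil => simp
  | cons i w ih => rw [wt_cons]; exact mul_pos (hc i) ih

lemma wt_le_one (hc : ∀ i, 0 < c i) (hc1 : ∀ i, c i ≤ 1) (w : List (Fin N)) : wt c w ≤ 1 := by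
  induction w with
  | nil => simp
  | cons i w ih => rw [wt_cons]; exact mul_le_one₀ (hc1 i) (wt_pos c hc w).le ih

lemma Sw_append (u w : List (Fin N)) (x : E) : Sw S (u ++ w) x = Sw S u (Sw S w x) := by
  induction u with
  | nil => rfl
  | cons i u ih => simp [Sw, ih]

lemma Sw_mem {K : Set E} (hK : ∀ i, ∀ x ∈ K, S i x ∈ K) (w : List (Fin N)) {x : E} (hx : x ∈ K) :
    Sw S w x ∈ K := by
  induction w with
  | nil => exact hx
  | cons i w ih => exact hK i _ ih

lemma Sw_surj (hS : ∀ i, Function.Surjective (S i)) (w : List (Fin N)) :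
    Function.Surjective (Sw S w) := by
  induction w with
  | nil => exact Function.surjective_id
  | cons i w ih => exact (hS i).comp ih

lemma Sw_dist [MetricSpace E] (hsim : ∀ i x y, dist (S i x) (S i y) = c i * dist x y)
    (w : List (Fin N)) (x y : E) : dist (Sw S w x) (Sw S w y) = wt c w * dist x y := by
  induction w with
  | nil => simp [Sw]
  | cons i w ih => simp [Sw, hsim, ih, mul_assoc]

lemma Sw_cont [MetricSpace E] (hsim : ∀ i x y, dist (S i x) (S i y) = c i * dist x y)
    (hc : ∀ i, 0 < c i) (w : List (Fin N)) : Continuous (Sw S w) := by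
  have : LipschitzWith (wt c w).toNNReal (Sw S w) := LipschitzWith.of_dist_le_mul fun x y => by
    rw [Sw_dist S c hsim, Real.coe_toNNReal _ (wt_pos c hc w).le]
  exact this.continuous

lemma Sw_inj [MetricSpace E] (hsim : ∀ i x y, dist (S i x) (S i y) = c i * dist x y)
    (hc : ∀ i, 0 < c i) (w : List (Fin N)) : Function.Injective (Sw S w) := by
  intro x y h
  have := Sw_dist S c hsim w x y
  rw [h, dist_self] at this
  rcases mul_eq_zero.1 this.symm with h | h
  · exact absurd h (wt_pos c hc w).ne'
  · exact dist_eq_zero.1 h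

lemma Dv.symm {a b : List (Fin N)} (h : Dv a b) : Dv b a := by
  obtain ⟨u, i, j, a', b', hij, h1, h2⟩ := h
  exact ⟨u, j, i, b', a', hij.symm, h2, h1⟩

lemma Dv.ne {a b : List (Fin N)} (h : Dv a b) : a ≠ b := by
  obtain ⟨u, i, j, a', b', hij, h1, h2⟩ := h
  rintro rfl
  rw [h1] at h2
  simp at h2
  exact hij h2.1

lemma Dv.append {a b : List (Fin N)} (h : Dv a b) (w : List (Fin N)) : Dv (w ++ a) (w ++ b) := by
  obtain ⟨u, i, j, a', b', hij, h1, h2⟩ := h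
  exact ⟨w ++ u, i, j, a', b', hij, by simp [h1], by simp [h2]⟩

lemma cut_sum_aux (G : Fin N → Finset (List (Fin N))) {M : Type*} [AddCommMonoid M]
    (f : List (Fin N) → M) :
    ∑ a ∈ Finset.univ.biUnion (fun i => (G i).image (List.cons i)), f a
      = ∑ i, ∑ a ∈ G i, f (i :: a) := by
  rw [Finset.sum_biUnion]
  · refine Finset.sum_congr rfl fun i _ => ?_
    rw [Finset.sum_image]
    intro a _ b _ h
    simpa using h
  · intro i _ j _ hij
    rw [Function.onFun, Finset.disjoint_left]
    intro a ha hb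
    simp only [Finset.mem_image] at ha hb
    obtain ⟨x, _, rfl⟩ := ha
    obtain ⟨y, _, h⟩ := hb
    simp at h
    exact hij h.1.symm

lemma cut_sum {Γ : Finset (List (Fin N))} (h : IsCut Γ) (t : Fin N → ℝ) (ht : ∑ i, t i = 1) :
    ∑ a ∈ Γ, wt t a = 1 := by
  induction h with
  | nil => simp
  | node G h ih =>
    rw [cut_sum_aux]
    simp [← Finset.mul_sum, ih, ht]

lemma cut_dv {Γ : Finset (List (Fin N))} (h : IsCut Γ) :
    ∀ a ∈ Γ, ∀ b ∈ Γ, a ≠ b → Dv a b := by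
  induction h with
  | nil => 
    intro a ha b hb hab
    simp at ha hb
    exact absurd (ha.trans hb.symm) hab
  | node G h ih =>
    intro a ha b hb hab
    simp only [Finset.mem_biUnion, Finset.mem_univ, true_and, Finset.mem_image] at ha hb
    obtain ⟨i, a', ha', rfl⟩ := ha
    obtain ⟨j, b', hb', rfl⟩ := hb
    by_cases hij : i = j
    · subst hij
      exact (ih i a' ha' b' hb' (fun h => hab (by rw [h]))).append [i]
    · exact ⟨[], i, j, a', b', hij, rfl, rfl⟩

lemma cut_exists (t : Fin N → ℝ) (m0 M0 : ℝ) (hm0 : 0 < m0) (hm : ∀ i, m0 ≤ t i)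
    (hM : ∀ i, t i ≤ M0) (hM0 : 0 ≤ M0) (m : ℕ) :
    ∀ ε : ℝ, 0 < ε → M0 ^ m < ε → m0 * ε ≤ 1 →
      ∃ Γ : Finset (List (Fin N)), IsCut Γ ∧ ∀ a ∈ Γ, m0 * ε ≤ wt t a ∧ wt t a < ε := by
  induction m with
  | zero =>
    intro ε h0 h1 h2
    exact ⟨{[]}, IsCut.nil, by simpa using ⟨h2, h1⟩⟩
  | succ m ih =>
    intro ε h0 h1 h2
    by_cases h : 1 < ε
    · exact ⟨{[]}, IsCut.nil, by simpa using ⟨h2, h⟩⟩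
    have htp : ∀ i, 0 < t i := fun i => hm0.trans_le (hm i)
    have := fun i => ih (ε / t i) (div_pos h0 (htp i)) (by
      rw [lt_div_iff₀ (htp i)]
      refine lt_of_le_of_lt ?_ h1
      rw [pow_succ]
      exact mul_le_mul_of_nonneg_left (hM i) (pow_nonneg hM0 m)) (by
      rw [← mul_div_assoc, div_le_one (htp i)]
      push Not at h
      have := hm i
      nlinarith)
    choose G hG hG' using this
    refine ⟨_, IsCut.node G hG, ?_⟩
    intro a ha
    simp only [Finset.mem_biUnion, Finset.mem_univ, true_and, Finset.mem_image] at ha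
    obtain ⟨i, a', ha', rfl⟩ := ha
    obtain ⟨h3, h4⟩ := hG' i a' ha'
    rw [← mul_div_assoc, div_le_iff₀ (htp i)] at h3
    rw [lt_div_iff₀ (htp i)] at h4
    rw [wt_cons, mul_comm (t i)]
    exact ⟨h3, h4⟩

lemma addr_exists {K : Set E} (hK : ∀ y ∈ K, ∃ i, ∃ x ∈ K, S i x = y)
    (m0 M0 : ℝ) (hm0 : 0 < m0) (hm : ∀ i, m0 ≤ c i)
    (hM : ∀ i, c i ≤ M0) (hM0 : 0 ≤ M0) (m : ℕ) :
    ∀ s : ℝ, 0 < s → M0 ^ m < s → m0 * s ≤ 1 → ∀ y ∈ K,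
      ∃ w, ∃ x ∈ K, Sw S w x = y ∧ m0 * s ≤ wt c w ∧ wt c w ≤ s := by
  induction m with
  | zero =>
    intro s h0 h1 h2 y hy
    exact ⟨[], y, hy, rfl, by simpa using h2, by simpa using h1.le⟩
  | succ m ih =>
    intro s h0 h1 h2 y hy
    by_cases h : 1 < s
    · exact ⟨[], y, hy, rfl, by simpa using h2, by simpa using h.le⟩
    obtain ⟨i, x, hx, rfl⟩ := hK y hy
    have htp : 0 < c i := hm0.trans_le (hm i)
    obtain ⟨w, x', hx', rfl, h3, h4⟩ := ih (s / c i) (div_pos h0 htp) (by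
      rw [lt_div_iff₀ htp]
      refine lt_of_le_of_lt ?_ h1
      rw [pow_succ]
      exact mul_le_mul_of_nonneg_left (hM i) (pow_nonneg hM0 m)) (by
      rw [← mul_div_assoc, div_le_one htp]
      push Not at h
      have := hm i
      nlinarith) x hx
    refine ⟨i :: w, x', hx', rfl, ?_⟩
    rw [← mul_div_assoc, div_le_iff₀ htp] at h3
    rw [le_div_iff₀ htp] at h4
    rw [wt_cons, mul_comm (c i)]
    exact ⟨h3, h4⟩

end words

section sosc
variable {E : Type*} [NormedAddCommGroup E] [NormedSpace ℝ E] [FiniteDimensional ℝ E] {N : ℕ}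

lemma packing (R δ : ℝ) (hδ : 0 < δ) : ∃ M : ℕ, ∀ (ι : Type) (T : Finset ι) (f : ι → E) (z : E)
    (s : ℝ), 0 < s → (∀ a ∈ T, dist (f a) z ≤ R * s) →
    (∀ a ∈ T, ∀ b ∈ T, a ≠ b → δ * s ≤ dist (f a) (f b)) → T.card ≤ M := by
  have : ProperSpace E := FiniteDimensional.proper ℝ E
  have htb : TotallyBounded (Metric.closedBall (0 : E) R) :=
    (isCompact_closedBall (0 : E) R).totallyBounded
  obtain ⟨t, htf, ht⟩ := Metric.totallyBounded_iff.1 htb (δ / 2) (by positivity)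
  refine ⟨htf.toFinset.card, fun ι T f z s hs h1 h2 => ?_⟩
  have h3 : ∀ a ∈ T, ∃ y ∈ t, dist (s⁻¹ • (f a - z)) y < δ / 2 := by
    intro a ha
    have : s⁻¹ • (f a - z) ∈ Metric.closedBall (0 : E) R := by
      rw [mem_closedBall_zero_iff, norm_smul, ← dist_eq_norm, Real.norm_eq_abs,
        abs_of_pos (inv_pos.2 hs), inv_mul_le_iff₀ hs, mul_comm s]
      exact h1 a ha
    simpa using ht this
  choose! g hg hg' using h3
  refine Finset.card_le_card_of_injOn g (fun a ha => by simpa using hg a ha) ?_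
  intro a ha b hb hab
  by_contra hne
  have h4 := h2 a ha b hb hne
  have h5 := hg' a ha
  have h6 := hg' b hb
  rw [← hab] at h6
  have h7 : dist (s⁻¹ • (f a - z)) (s⁻¹ • (f b - z)) < δ := by
    have := dist_triangle_right (s⁻¹ • (f a - z)) (s⁻¹ • (f b - z)) (g a)
    linarith
  rw [dist_smul₀, dist_sub_right, Real.norm_eq_abs, abs_of_pos (inv_pos.2 hs),
    inv_mul_lt_iff₀ hs] at h7
  linarith

lemma osc_disj (S : Fin N → E → E) (c : Fin N → ℝ) (hc : ∀ i, 0 < c i)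
    (hsim : ∀ i x y, dist (S i x) (S i y) = c i * dist x y)
    (U : Set E) (hU : ∀ i, ∀ x ∈ U, S i x ∈ U)
    (hd : ∀ i j, i ≠ j → ∀ x ∈ U, ∀ y ∈ U, S i x ≠ S j y) {a b : List (Fin N)} (h : Dv a b) :
    ∀ x ∈ U, ∀ y ∈ U, Sw S a x ≠ Sw S b y := by
  obtain ⟨u, i, j, a', b', hij, rfl, rfl⟩ := h
  intro x hx y hy he
  rw [Sw_append, Sw_append] at he
  have := Sw_inj S c hsim hc u he
  exact hd i j hij _ (Sw_mem S hU a' hx) _ (Sw_mem S hU b' hy) this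

/-- valid families of neighbours (Bandt–Graf, Schief) -/
def Valid (S : Fin N → E → E) (c : Fin N → ℝ) (K : Set E) (m0 : ℝ) (σ : List (Fin N))
    (T : Finset (List (Fin N))) : Prop :=
  (∀ a ∈ T, ∀ b ∈ T, a ≠ b → Dv a b) ∧
  ∀ τ ∈ T, m0 * wt c σ ≤ wt c τ ∧ wt c τ ≤ wt c σ ∧
    ∃ x ∈ K, ∃ y ∈ K, dist (Sw S τ x) (Sw S σ y) < wt c σ

lemma valid_bdd (S : Fin N → E → E) (c : Fin N → ℝ) (hc : ∀ i, 0 < c i)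
    (hsim : ∀ i x y, dist (S i x) (S i y) = c i * dist x y)
    (hsurj : ∀ i, Function.Surjective (S i))
    (U : Set E) (hUne : U.Nonempty) (hUo : IsOpen U) (hU : ∀ i, ∀ x ∈ U, S i x ∈ U)
    (hd : ∀ i j, i ≠ j → ∀ x ∈ U, ∀ y ∈ U, S i x ≠ S j y)
    (K : Set E) (x0 : E) (D : ℝ) (hKD : ∀ x ∈ K, dist x x0 ≤ D) (m0 : ℝ) (hm0 : 0 < m0) :
    ∃ M : ℕ, ∀ σ T, Valid S c K m0 σ T → T.card ≤ M := by
  obtain ⟨u0, hu0⟩ := hUne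
  obtain ⟨ρ, hρ, hball⟩ := Metric.isOpen_iff.1 hUo u0 hu0
  obtain ⟨M, hM⟩ := packing (E := E) (dist u0 x0 + D + 1 + D) (ρ * m0) (by positivity)
  refine ⟨M, fun σ T ⟨h1, h2⟩ => ?_⟩
  refine hM _ T (fun a => Sw S a u0) (Sw S σ x0) (wt c σ) (wt_pos c hc σ) ?_ ?_
  · intro a ha
    obtain ⟨_, h3, x, hx, y, hy, h4⟩ := h2 a ha
    have e1 := Sw_dist S c hsim a u0 x
    have e2 := Sw_dist S c hsim σ y x0
    have e3 := hKD y hy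
    have e4 := hKD x hx
    have e5 : dist u0 x ≤ dist u0 x0 + D := (dist_triangle_right u0 x x0).trans (by linarith)
    have e6 := dist_triangle4 (Sw S a u0) (Sw S a x) (Sw S σ y) (Sw S σ x0)
    have hp := wt_pos c hc σ
    have e7 : wt c a * dist u0 x ≤ wt c σ * (dist u0 x0 + D) :=
      mul_le_mul h3 e5 dist_nonneg hp.le
    have e8 : wt c σ * dist y x0 ≤ wt c σ * D := mul_le_mul_of_nonneg_left e3 hp.le

    nlinarith
  · intro a ha b hb hab
    by_contra hlt
    push Not at hlt
    obtain ⟨h3, _⟩ := h2 a ha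
    obtain ⟨v, hv⟩ := Sw_surj S hsurj a (Sw S b u0)
    have e1 := Sw_dist S c hsim a u0 v
    rw [hv] at e1
    have hpa := wt_pos c hc a
    have : dist v u0 < ρ := by
      rw [dist_comm]
      by_contra hge
      push Not at hge
      have : wt c a * ρ ≤ wt c a * dist u0 v := mul_le_mul_of_nonneg_left hge hpa.le
      nlinarith
    exact osc_disj S c hc hsim U hU hd (h1 a ha b hb hab) v (hball this) u0 hu0 hv

lemma sosc (S : Fin N → E → E) (c : Fin N → ℝ) (hc : ∀ i, 0 < c i) (hc1 : ∀ i, c i < 1)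
    (hsim : ∀ i x y, dist (S i x) (S i y) = c i * dist x y)
    (hsurj : ∀ i, Function.Surjective (S i))
    (U : Set E) (hUne : U.Nonempty) (hUo : IsOpen U) (hU : ∀ i, ∀ x ∈ U, S i x ∈ U)
    (hd : ∀ i j, i ≠ j → ∀ x ∈ U, ∀ y ∈ U, S i x ≠ S j y)
    (K : Set E) (x0 : E) (D : ℝ) (hKD : ∀ x ∈ K, dist x x0 ≤ D)
    (hK1 : ∀ y ∈ K, ∃ i, ∃ x ∈ K, S i x = y)
    (m0 M0 : ℝ) (hm0 : 0 < m0) (hm : ∀ i, m0 ≤ c i)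
    (hM : ∀ i, c i ≤ M0) (hM0 : 0 ≤ M0) (hM1 : M0 < 1) :
    ∃ σ : List (Fin N), ∀ i j, i ≠ j → ∀ ω : List (Fin N), ∀ x ∈ K, ∀ y ∈ K,
      wt c (i :: ω ++ σ) ≤ dist (Sw S (i :: ω ++ σ) x) (S j y) := by
  obtain ⟨M, hMb⟩ := valid_bdd S c hc hsim hsurj U hUne hUo hU hd K x0 D hKD m0 hm0
  let A : Set ℕ := {n | ∃ σ T, Valid S c K m0 σ T ∧ T.card = n}
  have hAne : A.Nonempty := ⟨0, [], ∅, ⟨by simp, by simp⟩, rfl⟩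
  have hAb : BddAbove A := ⟨M, by rintro n ⟨σ, T, h, rfl⟩; exact hMb σ T h⟩
  obtain ⟨σ, T, hT, hcard⟩ := Nat.sSup_mem hAne hAb
  refine ⟨σ, fun i j hij ω x hx y hy => ?_⟩
  by_contra hlt
  push Not at hlt
  set s := wt c (i :: ω ++ σ) with hs
  have hsp : 0 < s := wt_pos c hc _
  have hs1 : s ≤ 1 := wt_le_one c hc (fun i => (hc1 i).le) _
  obtain ⟨m, hm'⟩ := exists_pow_lt_of_lt_one (div_pos hsp (hc j)) hM1
  obtain ⟨w, y', hy', rfl, h3, h4⟩ := addr_exists S c hK1 m0 M0 hm0 hm hM hM0 m (s / c j)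
    (div_pos hsp (hc j)) hm' (by
      rw [← mul_div_assoc, div_le_one (hc j)]
      have := hm j
      nlinarith) y hy
  rw [← mul_div_assoc, div_le_iff₀ (hc j)] at h3
  rw [le_div_iff₀ (hc j)] at h4
  have hnot : j :: w ∉ T.image (fun a => (i :: ω) ++ a) := by
    simp only [Finset.mem_image, not_exists, not_and]
    intro a _ h
    simp at h
    exact hij h.1
  have hval : Valid S c K m0 (i :: ω ++ σ)
      (insert (j :: w) (T.image (fun a => (i :: ω) ++ a))) := by
    obtain ⟨v1, v2⟩ := hT
    constructor
    · intro a ha b hb hab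
      simp only [Finset.mem_insert, Finset.mem_image] at ha hb
      rcases ha with rfl | ⟨a', ha', rfl⟩ <;> rcases hb with rfl | ⟨b', hb', rfl⟩
      · exact absurd rfl hab
      · exact ⟨[], j, i, w, ω ++ b', hij.symm, rfl, rfl⟩
      · exact ⟨[], i, j, ω ++ a', w, hij, rfl, rfl⟩
      · exact (v1 a' ha' b' hb' (fun h => hab (by rw [h]))).append _
    · intro τ hτ
      simp only [Finset.mem_insert, Finset.mem_image] at hτ
      rcases hτ with rfl | ⟨a', ha', rfl⟩
      · refine ⟨?_, ?_, y', hy', x, hx, ?_⟩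
        · rw [wt_cons, mul_comm (c j)]; exact h3
        · rw [wt_cons, mul_comm (c j)]; exact h4
        · rw [dist_comm]; exact hlt
      · obtain ⟨w1, w2, x1, hx1, y1, hy1, w3⟩ := v2 a' ha'
        have hp := wt_pos c hc (i :: ω)
        refine ⟨?_, ?_, x1, hx1, y1, hy1, ?_⟩
        · rw [wt_append, wt_append]; nlinarith
        · rw [wt_append, wt_append]; nlinarith
        · rw [Sw_append, Sw_append, Sw_dist S c hsim, wt_append]
          exact mul_lt_mul_of_pos_left w3 hp
  have hmem : T.card + 1 ∈ A := by
    refine ⟨_, _, hval, ?_⟩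
    rw [Finset.card_insert_of_notMem hnot, Finset.card_image_of_injective _ (List.append_right_injective _)]
  have := le_csSup hAb hmem
  omega

end sosc

section meas
variable {E : Type*} [NormedAddCommGroup E] [NormedSpace ℝ E] [FiniteDimensional ℝ E]
  [MeasurableSpace E] [BorelSpace E] {N : ℕ}

lemma S_cont (S : Fin N → E → E) (c : Fin N → ℝ) (hc : ∀ i, 0 < c i)
    (hsim : ∀ i x y, dist (S i x) (S i y) = c i * dist x y) (i : Fin N) : Continuous (S i) :=
  Sw_cont S c hsim hc [i]

lemma self_lint (S : Fin N → E → E) (hS : ∀ i, Continuous (S i)) (p : Fin N → ℝ) (P : Measure E)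
    (hP : P = ∑ i, ENNReal.ofReal (p i) • P.map (S i)) (f : E → ℝ≥0∞) (hf : Measurable f) :
    ∫⁻ x, f x ∂P = ∑ i, ENNReal.ofReal (p i) * ∫⁻ x, f (S i x) ∂P := by
  conv_lhs => rw [hP]
  rw [lintegral_finsetSum_measure]
  refine Finset.sum_congr rfl fun i _ => ?_
  rw [lintegral_smul_measure, lintegral_map hf (hS i).measurable, smul_eq_mul]

lemma self_meas (S : Fin N → E → E) (hS : ∀ i, Continuous (S i)) (p : Fin N → ℝ) (P : Measure E)
    (hP : P = ∑ i, ENNReal.ofReal (p i) • P.map (S i)) (A : Set E) (hA : MeasurableSet A) :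
    P A = ∑ i, ENNReal.ofReal (p i) * P (S i ⁻¹' A) := by
  conv_lhs => rw [hP]
  rw [Measure.finsetSum_apply]
  refine Finset.sum_congr rfl fun i _ => ?_
  rw [Measure.smul_apply, Measure.map_apply (hS i).measurable hA, smul_eq_mul]

lemma sum_ofReal_p (p : Fin N → ℝ) (hp : ∀ i, 0 < p i) (hp1 : ∑ i, p i = 1) :
    ∑ i, ENNReal.ofReal (p i) = 1 := by
  rw [← ENNReal.ofReal_sum_of_nonneg (fun i _ => (hp i).le), hp1, ENNReal.ofReal_one]

lemma cut_lint (S : Fin N → E → E) (hS : ∀ i, Continuous (S i)) (p : Fin N → ℝ)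
    (hp : ∀ i, 0 < p i) (P : Measure E)
    (hP : P = ∑ i, ENNReal.ofReal (p i) • P.map (S i))
    {Γ : Finset (List (Fin N))} (h : IsCut Γ) :
    ∀ (f : E → ℝ≥0∞), Measurable f →
    ∫⁻ x, f x ∂P = ∑ a ∈ Γ, ENNReal.ofReal (wt p a) * ∫⁻ x, f (Sw S a x) ∂P := by
  induction h with
  | nil => intro f hf; simp [Sw]
  | node G h ih =>
    intro f hf
    rw [cut_sum_aux, self_lint S hS p P hP f hf]
    refine Finset.sum_congr rfl fun i _ => ?_
    rw [ih i (fun x => f (S i x)) (hf.comp (hS i).measurable), Finset.mul_sum]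
    refine Finset.sum_congr rfl fun a _ => ?_
    rw [wt_cons, ENNReal.ofReal_mul (hp i).le, mul_assoc]
    rfl

/-- the measure is carried by a ball which is mapped into itself -/
lemma ball_exists (S : Fin N → E → E) (c : Fin N → ℝ) (hc : ∀ i, 0 < c i)
    (hsim : ∀ i x y, dist (S i x) (S i y) = c i * dist x y)
    (M0 : ℝ) (hM : ∀ i, c i ≤ M0) (hM0 : 0 < M0) (hM1 : M0 < 1)
    (p : Fin N → ℝ) (hp : ∀ i, 0 < p i) (hp1 : ∑ i, p i = 1)
    (P : Measure E) [IsProbabilityMeasure P]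
    (hP : P = ∑ i, ENNReal.ofReal (p i) • P.map (S i)) :
    ∃ R : ℝ, 0 < R ∧ (∀ i x, dist x 0 ≤ R → dist (S i x) 0 ≤ R) ∧ ∀ᵐ x ∂P, dist x 0 ≤ R := by
  have hS := S_cont S c hc hsim
  set d0 : ℝ := ∑ i, dist (S i 0) 0 with hd0
  have hd0' : ∀ i, dist (S i 0) 0 ≤ d0 := fun i =>
    Finset.single_le_sum (f := fun i => dist (S i 0) 0) (fun _ _ => dist_nonneg) (Finset.mem_univ i)
  have hd00 : 0 ≤ d0 := Finset.sum_nonneg fun _ _ => dist_nonneg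
  have hg : ∀ i x, dist (S i x) 0 ≤ M0 * dist x 0 + d0 := by
    intro i x
    have h1 := dist_triangle (S i x) (S i 0) 0
    rw [hsim] at h1
    have h2 : c i * dist x 0 ≤ M0 * dist x 0 := mul_le_mul_of_nonneg_right (hM i) dist_nonneg
    linarith [hd0' i]
  set R : ℝ := d0 / (1 - M0) with hR
  have hR0 : 0 ≤ R := div_nonneg hd00 (by linarith)
  have hRe : M0 * R + d0 = R := by
    rw [hR]; field_simp [show (1 - M0) ≠ 0 by linarith]; ring
  let F : ℝ → ℝ≥0∞ := fun t => P {x | R + t < dist x 0}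
  have hstep : ∀ t, F t ≤ F (t / M0) := by
    intro t
    have hmeas : MeasurableSet {x : E | R + t < dist x 0} :=
      (isOpen_lt continuous_const (continuous_id.dist continuous_const)).measurableSet
    show P _ ≤ _
    rw [self_meas S hS p P hP _ hmeas]
    calc _ ≤ ∑ i, ENNReal.ofReal (p i) * F (t / M0) := by
          refine Finset.sum_le_sum fun i _ => ?_
          gcongr
          refine measure_mono fun x hx => ?_
          simp only [Set.mem_preimage, Set.mem_setOf_eq] at hx ⊢
          have h1 := hg i x
          have h2 : t < M0 * (dist x 0 - R) := by nlinarith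
          have h3 : t / M0 < dist x 0 - R := by rw [div_lt_iff₀ hM0]; linarith
          linarith
      _ = F (t / M0) := by rw [← Finset.sum_mul, sum_ofReal_p p hp hp1, one_mul]
  have hiter : ∀ m : ℕ, F 1 ≤ F (1 / M0 ^ m) := by
    intro m
    induction m with
    | zero => simp
    | succ m ih =>
      refine ih.trans ((hstep _).trans_eq ?_)
      rw [pow_succ, div_div]
  have hanti : ∀ n : ℕ, F 1 ≤ F n := by
    intro n
    obtain ⟨m, hm⟩ := exists_pow_lt_of_lt_one (show (0 : ℝ) < 1 / (n + 1) by positivity) hM1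
    refine (hiter m).trans (measure_mono fun x hx => ?_)
    simp only [Set.mem_setOf_eq] at hx ⊢
    have : (n : ℝ) + 1 ≤ 1 / M0 ^ m := by
      rw [lt_div_iff₀ (by positivity)] at hm
      rw [le_div_iff₀ (by positivity)]
      linarith
    linarith
  have hlim : Tendsto (fun n : ℕ => F n) atTop (nhds (P (⋂ n : ℕ, {x | R + (n : ℝ) < dist x 0}))) := by
    refine tendsto_measure_iInter_atTop (fun n => ?_) ?_ ⟨0, measure_ne_top _ _⟩
    · exact (isOpen_lt continuous_const
        (continuous_id.dist continuous_const)).measurableSet.nullMeasurableSet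
    · intro m n hmn x hx
      simp only [Set.mem_setOf_eq] at hx ⊢
      have : (m : ℝ) ≤ n := by exact_mod_cast hmn
      linarith
  have hemp : (⋂ n : ℕ, {x : E | R + (n : ℝ) < dist x 0}) = ∅ := by
    rw [Set.eq_empty_iff_forall_notMem]
    intro x hx
    simp only [Set.mem_iInter, Set.mem_setOf_eq] at hx
    obtain ⟨n, hn⟩ := exists_nat_gt (dist x 0)
    linarith [hx n]
  rw [hemp, measure_empty] at hlim
  have hF1 : F 1 = 0 := le_antisymm (ge_of_tendsto' hlim hanti) bot_le
  refine ⟨R + 1, by linarith, ?_, ?_⟩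
  · intro i x hx
    have := hg i x
    nlinarith
  · rw [ae_iff]
    simpa only [not_le] using hF1

/-- iterated images of the invariant ball -/
def BB (S : Fin N → E → E) (R : ℝ) : ℕ → Set E
  | 0 => Metric.closedBall 0 R
  | n + 1 => ⋃ i, S i '' BB S R n

lemma attractor (S : Fin N → E → E) (c : Fin N → ℝ) (hc : ∀ i, 0 < c i)
    (hsim : ∀ i x y, dist (S i x) (S i y) = c i * dist x y)
    (p : Fin N → ℝ) (P : Measure E) [IsProbabilityMeasure P]
    (hP : P = ∑ i, ENNReal.ofReal (p i) • P.map (S i))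
    (R : ℝ) (hR : ∀ i x, dist x 0 ≤ R → dist (S i x) 0 ≤ R) (hPR : ∀ᵐ x ∂P, dist x 0 ≤ R) :
    ∃ K : Set E, IsCompact K ∧ (∀ x ∈ K, dist x 0 ≤ R) ∧ (∀ i, ∀ x ∈ K, S i x ∈ K) ∧
      (∀ y ∈ K, ∃ i, ∃ x ∈ K, S i x = y) ∧ P K = 1 := by
  have : ProperSpace E := FiniteDimensional.proper ℝ E
  have hS := S_cont S c hc hsim
  have hcomp : ∀ n, IsCompact (BB S R n) := by
    intro n
    induction n with
    | zero => exact isCompact_closedBall _ _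
    | succ n ih => exact isCompact_iUnion fun i => ih.image (hS i)
  have hsucc : ∀ n, BB S R (n + 1) ⊆ BB S R n := by
    intro n
    induction n with
    | zero =>
      intro y hy
      simp only [BB, Set.mem_iUnion, Set.mem_image] at hy
      obtain ⟨i, x, hx, rfl⟩ := hy
      exact hR i x hx
    | succ n ih =>
      intro y hy
      rw [BB, Set.mem_iUnion] at hy
      obtain ⟨i, x, hx, rfl⟩ := hy
      exact Set.mem_iUnion.2 ⟨i, x, ih hx, rfl⟩
  have hanti : Antitone (BB S R) := antitone_nat_of_succ_le hsucc
  have hae : ∀ n, ∀ᵐ x ∂P, x ∈ BB S R n := by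
    intro n
    induction n with
    | zero => exact hPR
    | succ n ih =>
      rw [ae_iff] at ih ⊢
      have hm : MeasurableSet {a | a ∉ BB S R (n + 1)} := (hcomp (n + 1)).measurableSet.compl
      rw [self_meas S hS p P hP _ hm]
      refine Finset.sum_eq_zero fun i _ => ?_
      rw [measure_mono_null _ ih, mul_zero]
      intro x hx hx'
      exact hx (Set.mem_iUnion.2 ⟨i, x, hx', rfl⟩)
  refine ⟨⋂ n, BB S R n, ?_, ?_, ?_, ?_, ?_⟩
  · exact (hcomp 0).of_isClosed_subset (isClosed_iInter fun n => (hcomp n).isClosed)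
      (Set.iInter_subset _ 0)
  · intro x hx
    exact Set.mem_iInter.1 hx 0
  · intro i x hx
    refine Set.mem_iInter.2 fun n => hsucc n ?_
    exact Set.mem_iUnion.2 ⟨i, x, Set.mem_iInter.1 hx n, rfl⟩
  · intro y hy
    by_contra hcon
    push Not at hcon
    have h1 : ∀ i, ∃ n, y ∉ S i '' BB S R n := by
      intro i
      by_contra h2
      push Not at h2
      obtain ⟨x, _, hx⟩ := h2 0
      refine hcon i x (Set.mem_iInter.2 fun n => ?_) hx
      obtain ⟨x', hx', hx2⟩ := h2 n
      have : x' = x := Sw_inj S c hsim hc [i] (hx2.trans hx.symm)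
      exact this ▸ hx'
    choose n hn using h1
    have h2 := Set.mem_iInter.1 hy ((Finset.univ.sup n) + 1)
    obtain ⟨i, x, hx, hxy⟩ := Set.mem_iUnion.1 h2
    exact hn i ⟨x, hanti (Finset.le_sup (Finset.mem_univ i)) hx, hxy⟩
  · rw [← prob_compl_eq_zero_iff (MeasurableSet.iInter fun n => (hcomp n).measurableSet)]
    have : ∀ᵐ x ∂P, x ∈ ⋂ n, BB S R n := by
      simp only [Set.mem_iInter]
      exact ae_all_iff.2 hae
    exact this

lemma mass_lower (S : Fin N → E → E) (hS : ∀ i, Continuous (S i))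
    (p : Fin N → ℝ) (hp : ∀ i, 0 < p i) (P : Measure E)
    (hP : P = ∑ i, ENNReal.ofReal (p i) • P.map (S i)) (K : Set E) (hK : IsCompact K)
    (hPK : P K = 1) (w : List (Fin N)) :
    IsCompact (Sw S w '' K) ∧ ENNReal.ofReal (wt p w) ≤ P (Sw S w '' K) := by
  induction w with
  | nil => simp [Sw, hK, hPK]
  | cons i w ih =>
    have he : Sw S (i :: w) '' K = S i '' (Sw S w '' K) := by
      rw [Set.image_image]; rfl
    have hcm : IsCompact (S i '' (Sw S w '' K)) := ih.1.image (hS i)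
    rw [he]
    refine ⟨hcm, ?_⟩
    rw [self_meas S hS p P hP _ hcm.measurableSet, wt_cons, ENNReal.ofReal_mul (hp i).le]
    refine le_trans ?_ (Finset.single_le_sum (fun _ _ => bot_le) (Finset.mem_univ i))
    gcongr
    exact ih.2.trans (measure_mono (Set.subset_preimage_image _ _))

lemma wt_rpow (p c t : Fin N → ℝ) (hp : ∀ i, 0 < p i) (hc : ∀ i, 0 < c i) (r k : ℝ) (hr : 0 < r)
    (hk : 0 < k) (ht : ∀ i, t i = (p i * c i ^ r) ^ (k / (k + r))) (w : List (Fin N)) :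
    wt p w * wt c w ^ r = wt t w ^ (1 + r / k) := by
  have htp : ∀ i, 0 < t i := fun i => by
    rw [ht]; have := hp i; have := hc i; positivity
  induction w with
  | nil => simp
  | cons i w ih =>
    simp only [wt_cons]
    rw [Real.mul_rpow (hc i).le (wt_pos c hc w).le, Real.mul_rpow (htp i).le (wt_pos t htp w).le,
      ← ih]
    have : t i ^ (1 + r / k) = p i * c i ^ r := by
      have := hp i; have := hc i
      rw [ht, ← Real.rpow_mul (by positivity)]
      have : k / (k + r) * (1 + r / k) = 1 := by field_simp
      rw [this, Real.rpow_one]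
    rw [this]; ring

end meas

section main
variable {E : Type*} [NormedAddCommGroup E] [NormedSpace ℝ E] [FiniteDimensional ℝ E]
  [MeasurableSpace E] [BorelSpace E] {N : ℕ}

lemma int_eq (P : Measure E) (r : ℝ) (hr : 0 < r) (α : Set E) :
    ∫ x, infDist x α ^ r ∂P = (∫⁻ x, ENNReal.ofReal (infDist x α ^ r) ∂P).toReal := by
  refine integral_eq_lintegral_of_nonneg_ae (ae_of_all _ fun x => Real.rpow_nonneg infDist_nonneg _) ?_
  exact ((continuous_infDist_pt α).rpow_const (fun _ => Or.inr hr.le)).aestronglyMeasurable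

lemma upper (S : Fin N → E → E) (c : Fin N → ℝ) (hc : ∀ i, 0 < c i)
    (hsim : ∀ i x y, dist (S i x) (S i y) = c i * dist x y)
    (p t : Fin N → ℝ) (hp : ∀ i, 0 < p i)
    (P : Measure E) [IsProbabilityMeasure P]
    (hP : P = ∑ i, ENNReal.ofReal (p i) • P.map (S i))
    (r k : ℝ) (hr : 0 < r) (hk : 0 < k) (ht : ∀ i, t i = (p i * c i ^ r) ^ (k / (k + r)))
    (ht1 : ∑ i, t i = 1)
    (R : ℝ) (hR0 : 0 < R) (hPR : ∀ᵐ x ∂P, dist x 0 ≤ R)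
    (m0 M0 : ℝ) (hm0 : 0 < m0) (hm : ∀ i, m0 ≤ t i)
    (hM : ∀ i, t i ≤ M0) (hM0 : 0 ≤ M0) (hM1 : M0 < 1) :
    ∃ C : ℝ, 0 < C ∧ ∀ n : ℕ, 1 ≤ n → ∃ α : Finset E, 1 ≤ α.card ∧ α.card ≤ n ∧
      ∫ x, infDist x (↑α : Set E) ^ r ∂P ≤ C * (n : ℝ) ^ (-(r / k)) := by
  classical
  refine ⟨R ^ r * (1 / m0) ^ (r / k), by positivity, fun n hn => ?_⟩
  have hS := S_cont S c hc hsim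
  have hn0 : (0 : ℝ) < n := by exact_mod_cast hn
  have htp : ∀ i, 0 < t i := fun i => hm0.trans_le (hm i)
  set ε : ℝ := 1 / (m0 * n) with hε
  have hε0 : 0 < ε := by positivity
  obtain ⟨m, hm'⟩ := exists_pow_lt_of_lt_one hε0 hM1
  have hmn : m0 * ε = 1 / n := by rw [hε]; field_simp
  obtain ⟨Γ, hΓ, hΓ'⟩ := cut_exists t m0 M0 hm0 hm hM hM0 m ε hε0 hm' (by
    rw [hmn, div_le_one hn0]; exact_mod_cast hn)
  have hsum := cut_sum hΓ t ht1
  have hcard : Γ.card ≤ n := by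
    have h1 : (Γ.card : ℝ) * (1 / n) ≤ 1 := by
      rw [← hmn, ← nsmul_eq_mul]
      exact (Finset.card_nsmul_le_sum _ _ _ fun a ha => (hΓ' a ha).1).trans_eq hsum
    rw [mul_one_div, div_le_one hn0] at h1
    exact_mod_cast h1
  have hne : Γ.Nonempty := by
    rw [Finset.nonempty_iff_ne_empty]
    rintro rfl
    simp at hsum
  set α : Finset E := Γ.image (fun a => Sw S a 0) with hα
  refine ⟨α, ?_, Finset.card_image_le.trans hcard, ?_⟩
  · exact Finset.card_pos.2 (hne.image _)
  rw [int_eq P r hr]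
  refine ENNReal.toReal_le_of_le_ofReal (by positivity) ?_
  have hmeas : Measurable fun x : E => ENNReal.ofReal (infDist x (↑α : Set E) ^ r) :=
    ((continuous_infDist_pt _).rpow_const (fun _ => Or.inr hr.le)).measurable.ennreal_ofReal
  rw [cut_lint S hS p hp P hP hΓ _ hmeas]
  have hterm : ∀ a ∈ Γ, ENNReal.ofReal (wt p a) *
      ∫⁻ x, ENNReal.ofReal (infDist (Sw S a x) (↑α : Set E) ^ r) ∂P
      ≤ ENNReal.ofReal (R ^ r * ε ^ (r / k) * wt t a) := by
    intro a ha
    have hwt := wt_pos t htp a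
    have hwc := wt_pos c hc a
    have hwp := wt_pos p hp a
    have h1 : ∫⁻ x, ENNReal.ofReal (infDist (Sw S a x) (↑α : Set E) ^ r) ∂P
        ≤ ENNReal.ofReal ((wt c a * R) ^ r) := by
      calc _ ≤ ∫⁻ x, ENNReal.ofReal ((wt c a * R) ^ r) ∂P := by
            refine lintegral_mono_ae ?_
            filter_upwards [hPR] with x hx
            refine ENNReal.ofReal_le_ofReal (Real.rpow_le_rpow infDist_nonneg ?_ hr.le)
            have hmem : Sw S a 0 ∈ (↑α : Set E) := by
              rw [hα]; exact_mod_cast Finset.mem_image_of_mem _ ha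
            refine (infDist_le_dist_of_mem hmem).trans ?_
            rw [Sw_dist S c hsim]
            exact mul_le_mul_of_nonneg_left hx hwc.le
        _ = _ := by simp
    calc _ ≤ ENNReal.ofReal (wt p a) * ENNReal.ofReal ((wt c a * R) ^ r) := by gcongr
      _ = ENNReal.ofReal (wt p a * (wt c a * R) ^ r) := (ENNReal.ofReal_mul hwp.le).symm
      _ ≤ _ := by
        refine ENNReal.ofReal_le_ofReal ?_
        rw [Real.mul_rpow hwc.le hR0.le, ← mul_assoc, wt_rpow p c t hp hc r k hr hk ht,
          Real.rpow_add hwt, Real.rpow_one]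
        have : wt t a ^ (r / k) ≤ ε ^ (r / k) :=
          Real.rpow_le_rpow hwt.le (hΓ' a ha).2.le (by positivity)
        have hRr : 0 < R ^ r := by positivity
        calc wt t a * wt t a ^ (r / k) * R ^ r ≤ wt t a * ε ^ (r / k) * R ^ r := by gcongr
          _ = _ := by ring
  refine (Finset.sum_le_sum hterm).trans ?_
  rw [← ENNReal.ofReal_sum_of_nonneg (fun a _ => by have := wt_pos t htp a; positivity),
    ← Finset.mul_sum, hsum, mul_one]
  refine ENNReal.ofReal_le_ofReal (le_of_eq ?_)
  rw [hε, ← one_div_mul_one_div, Real.mul_rpow (by positivity) (by positivity), mul_assoc]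
  congr 2
  rw [one_div, Real.inv_rpow hn0.le, Real.rpow_neg hn0.le]

lemma lower (S : Fin N → E → E) (c : Fin N → ℝ) (hc : ∀ i, 0 < c i)
    (hsim : ∀ i x y, dist (S i x) (S i y) = c i * dist x y)
    (p t : Fin N → ℝ) (hp : ∀ i, 0 < p i)
    (P : Measure E) [IsProbabilityMeasure P]
    (hP : P = ∑ i, ENNReal.ofReal (p i) • P.map (S i))
    (r k : ℝ) (hr : 0 < r) (hk : 0 < k) (ht : ∀ i, t i = (p i * c i ^ r) ^ (k / (k + r)))
    (ht1 : ∑ i, t i = 1)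
    (R : ℝ) (hPR : ∀ᵐ x ∂P, dist x 0 ≤ R)
    (m0 M0 : ℝ) (hm0 : 0 < m0) (hm01 : m0 ≤ 1) (hm : ∀ i, m0 ≤ t i)
    (hM : ∀ i, t i ≤ M0) (hM0 : 0 ≤ M0) (hM1 : M0 < 1)
    (K : Set E) (hKc : IsCompact K) (hKS : ∀ i, ∀ x ∈ K, S i x ∈ K) (hPK : P K = 1)
    (σ : List (Fin N)) (hσ : ∀ i j, i ≠ j → ∀ ω : List (Fin N), ∀ x ∈ K, ∀ y ∈ K,
      wt c (i :: ω ++ σ) ≤ dist (Sw S (i :: ω ++ σ) x) (S j y)) :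
    ∃ C : ℝ, 0 < C ∧ ∀ n : ℕ, 1 ≤ n → ∀ α : Finset E, 1 ≤ α.card → α.card ≤ n →
      C * (n : ℝ) ^ (-(r / k)) ≤ ∫ x, infDist x (↑α : Set E) ^ r ∂P := by
  classical
  have htp : ∀ i, 0 < t i := fun i => hm0.trans_le (hm i)
  have hS := S_cont S c hc hsim
  have hσt := wt_pos t htp σ
  refine ⟨(1 / 2) ^ r * wt t σ ^ (1 + r / k) * (m0 / 2) ^ (1 + r / k), by positivity,
    fun n hn α hα1 hαn => ?_⟩
  have hn0 : (0 : ℝ) < n := by exact_mod_cast hn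
  have hn1 : (1 : ℝ) ≤ n := by exact_mod_cast hn
  set ε : ℝ := 1 / (2 * n) with hε
  have hε0 : 0 < ε := by positivity
  have hε1 : ε ≤ 1 := by rw [hε, div_le_one (by positivity)]; linarith
  obtain ⟨m, hm'⟩ := exists_pow_lt_of_lt_one hε0 hM1
  obtain ⟨Γ, hΓ, hΓ'⟩ := cut_exists t m0 M0 hm0 hm hM hM0 m ε hε0 hm' (by nlinarith)
  have hsum := cut_sum hΓ t ht1
  have hcard : 2 * n ≤ Γ.card := by
    have h1 : 1 ≤ (Γ.card : ℝ) * ε := by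
      rw [← hsum, ← nsmul_eq_mul]
      exact Finset.sum_le_card_nsmul _ _ _ fun a ha => (hΓ' a ha).2.le
    rw [hε, mul_one_div, le_div_iff₀ (by positivity), one_mul] at h1
    exact_mod_cast h1
  have hsep1 : ∀ a b, Dv a b → ∀ x ∈ K, ∀ y ∈ K,
      wt c (a ++ σ) ≤ dist (Sw S (a ++ σ) x) (Sw S (b ++ σ) y) := by
    rintro a b ⟨u, i, j, a', b', hij, rfl, rfl⟩ x hx y hy
    rw [List.append_assoc, List.append_assoc, Sw_append, Sw_append S u, Sw_dist S c hsim, wt_append]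
    refine mul_le_mul_of_nonneg_left ?_ (wt_pos c hc u).le
    exact hσ i j hij a' x hx _ (Sw_mem S hKS (b' ++ σ) hy)
  have hsep : ∀ a ∈ Γ, ∀ b ∈ Γ, a ≠ b → ∀ x ∈ K, ∀ y ∈ K,
      (wt c (a ++ σ) + wt c (b ++ σ)) / 2 ≤ dist (Sw S (a ++ σ) x) (Sw S (b ++ σ) y) := by
    intro a ha b hb hab x hx y hy
    have hd := cut_dv hΓ a ha b hb hab
    have h1 := hsep1 a b hd x hx y hy
    have h2 := hsep1 b a hd.symm y hy x hx
    rw [dist_comm] at h2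
    linarith
  set bad : Finset (List (Fin N)) :=
    Γ.filter (fun a => ∃ z ∈ α, ∃ x ∈ K, dist (Sw S (a ++ σ) x) z < wt c (a ++ σ) / 2) with hbad
  have hbadc : bad.card ≤ n := by
    refine le_trans ?_ hαn
    have h1 : ∀ a ∈ bad, ∃ z ∈ α, ∃ x ∈ K, dist (Sw S (a ++ σ) x) z < wt c (a ++ σ) / 2 :=
      fun a ha => (Finset.mem_filter.1 ha).2
    choose! g hg hg' using h1
    refine Finset.card_le_card_of_injOn g (fun a ha => hg a ha) ?_
    intro a ha b hb hab
    by_contra hne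
    obtain ⟨x, hx, h2⟩ := hg' a ha
    obtain ⟨y, hy, h3⟩ := hg' b hb
    rw [← hab] at h3
    have h4 := hsep a (Finset.mem_filter.1 ha).1 b (Finset.mem_filter.1 hb).1 hne x hx y hy
    have h5 := dist_triangle_right (Sw S (a ++ σ) x) (Sw S (b ++ σ) y) (g a)
    linarith
  set good := Γ \ bad with hgood
  have hgoodc : n ≤ good.card := by
    have h1 : good.card = Γ.card - bad.card :=
      Finset.card_sdiff_of_subset (Finset.filter_subset _ _)
    omega
  have hαne : (↑α : Set E).Nonempty := by
    rw [Finset.coe_nonempty]; exact Finset.card_pos.1 hα1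
  have hgood' : ∀ a ∈ good, ∀ y ∈ Sw S (a ++ σ) '' K, wt c (a ++ σ) / 2 ≤ infDist y (↑α : Set E) := by
    rintro a ha _ ⟨x, hx, rfl⟩
    rw [hgood, Finset.mem_sdiff, hbad, Finset.mem_filter] at ha
    obtain ⟨ha1, ha2⟩ := ha
    rw [le_infDist hαne]
    intro z hz
    by_contra hlt
    push Not at hlt
    exact ha2 ⟨ha1, z, hz, x, hx, hlt⟩
  have hgΓ : ∀ a ∈ good, a ∈ Γ := fun a ha => (Finset.mem_sdiff.1 ha).1
  have hfin : ∫⁻ x, ENNReal.ofReal (infDist x (↑α : Set E) ^ r) ∂P ≠ ∞ := by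
    obtain ⟨z, hz⟩ := hαne
    have h1 : ∫⁻ x, ENNReal.ofReal (infDist x (↑α : Set E) ^ r) ∂P ≤
        ∫⁻ x, ENNReal.ofReal ((R + dist z 0) ^ r) ∂P := by
      refine lintegral_mono_ae ?_
      filter_upwards [hPR] with x hx
      refine ENNReal.ofReal_le_ofReal (Real.rpow_le_rpow infDist_nonneg ?_ hr.le)
      refine (infDist_le_dist_of_mem hz).trans ((dist_triangle_right x z 0).trans ?_)
      linarith
    refine (lt_of_le_of_lt h1 ?_).ne
    simp
  rw [int_eq P r hr, ← ENNReal.ofReal_le_iff_le_toReal hfin]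
  have hcompact := fun a => mass_lower S hS p hp P hP K hKc hPK (a ++ σ)
  have hdisj : Set.PairwiseDisjoint (↑good : Set (List (Fin N))) (fun a => Sw S (a ++ σ) '' K) := by
    intro a ha b hb hab
    rw [Function.onFun, Set.disjoint_left]
    rintro _ ⟨x, hx, rfl⟩ ⟨y, hy, hxy⟩
    have h1 := hsep a (hgΓ a ha) b (hgΓ b hb) hab x hx y hy
    rw [hxy, dist_self] at h1
    have h2 := wt_pos c hc (a ++ σ)
    have h3 := wt_pos c hc (b ++ σ)
    linarith
  calc _ ≤ ENNReal.ofReal (∑ a ∈ good,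
          ((1 / 2) ^ r * wt t σ ^ (1 + r / k) * (m0 * ε) ^ (1 + r / k))) := by
        refine ENNReal.ofReal_le_ofReal ?_
        rw [Finset.sum_const, nsmul_eq_mul]
        have h1 : (n : ℝ) ≤ good.card := by exact_mod_cast hgoodc
        have h2 : m0 * ε = (m0 / 2) * (n : ℝ)⁻¹ := by rw [hε]; field_simp
        have h3 : (n : ℝ) ^ (-(r / k)) = n * ((n : ℝ)⁻¹) ^ (1 + r / k) := by
          rw [Real.inv_rpow hn0.le, ← Real.rpow_neg hn0.le]
          nth_rewrite 2 [← Real.rpow_one (n : ℝ)]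
          rw [← Real.rpow_add hn0]
          congr 1; ring
        rw [h2, Real.mul_rpow (by positivity) (by positivity), h3]
        calc _ = (n : ℝ) * ((1 / 2) ^ r * wt t σ ^ (1 + r / k) *
              ((m0 / 2) ^ (1 + r / k) * (n : ℝ)⁻¹ ^ (1 + r / k))) := by ring
          _ ≤ _ := by gcongr
    _ = ∑ a ∈ good, ENNReal.ofReal
          ((1 / 2) ^ r * wt t σ ^ (1 + r / k) * (m0 * ε) ^ (1 + r / k)) :=
        ENNReal.ofReal_sum_of_nonneg fun a _ => by positivity
    _ ≤ ∑ a ∈ good, ∫⁻ x in Sw S (a ++ σ) '' K, ENNReal.ofReal (infDist x (↑α : Set E) ^ r) ∂P := by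
        refine Finset.sum_le_sum fun a ha => ?_
        have hwc := wt_pos c hc (a ++ σ)
        have hwp := wt_pos p hp (a ++ σ)
        have hwt := wt_pos t htp a
        calc _ ≤ ENNReal.ofReal ((wt c (a ++ σ) / 2) ^ r * wt p (a ++ σ)) := by
              refine ENNReal.ofReal_le_ofReal ?_
              have h1 : (wt c (a ++ σ) / 2) ^ r * wt p (a ++ σ)
                  = (1 / 2) ^ r * wt t σ ^ (1 + r / k) * wt t a ^ (1 + r / k) := by
                rw [div_eq_mul_one_div, Real.mul_rpow hwc.le (by positivity)]
                calc _ = (1 / 2) ^ r * (wt p (a ++ σ) * wt c (a ++ σ) ^ r) := by ring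
                  _ = _ := by
                    rw [wt_rpow p c t hp hc r k hr hk ht, wt_append, Real.mul_rpow hwt.le hσt.le]
                    ring
              rw [h1]
              have := (hΓ' a (hgΓ a ha)).1
              gcongr
          _ = ENNReal.ofReal ((wt c (a ++ σ) / 2) ^ r) * ENNReal.ofReal (wt p (a ++ σ)) :=
              ENNReal.ofReal_mul (by positivity)
          _ ≤ ENNReal.ofReal ((wt c (a ++ σ) / 2) ^ r) * P (Sw S (a ++ σ) '' K) := by
              gcongr
              exact (hcompact a).2
          _ = ∫⁻ x in Sw S (a ++ σ) '' K, ENNReal.ofReal ((wt c (a ++ σ) / 2) ^ r) ∂P := by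
              rw [setLIntegral_const]
          _ ≤ _ := by
              refine setLIntegral_mono' (hcompact a).1.measurableSet fun y hy => ?_
              exact ENNReal.ofReal_le_ofReal
                (Real.rpow_le_rpow (by positivity) (hgood' a ha y hy) hr.le)
    _ = ∫⁻ x in ⋃ a ∈ good, Sw S (a ++ σ) '' K, ENNReal.ofReal (infDist x (↑α : Set E) ^ r) ∂P :=
        (lintegral_biUnion_finset hdisj (fun a _ => (hcompact a).1.measurableSet) _).symm
    _ ≤ _ := setLIntegral_le_lintegral _ _

end main

lemma sim_surj {q : ℕ} (f : EuclideanSpace ℝ (Fin q) → EuclideanSpace ℝ (Fin q)) (c : ℝ)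
    (hc : 0 < c) (hf : ∀ x y, dist (f x) (f y) = c * dist x y) : Function.Surjective f := by
  have hi : Isometry fun x => c⁻¹ • f x := Isometry.of_dist_eq fun x y => by
    rw [dist_smul₀, hf, Real.norm_eq_abs, abs_of_pos (inv_pos.2 hc), inv_mul_cancel_left₀ hc.ne']
  let e := hi.affineIsometryOfStrictConvexSpace.toAffineIsometryEquiv rfl
  intro y
  obtain ⟨x, hx⟩ := e.surjective (c⁻¹ • y)
  refine ⟨x, ?_⟩
  have hx' : c⁻¹ • f x = c⁻¹ • y := hx
  exact smul_right_injective _ (inv_pos.2 hc).ne' hx'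

lemma asympt (e : ℕ → ℝ) (k A B : ℝ) (hk : 0 < k) (hA : 0 < A) (hB : 0 < B)
    (h1 : ∀ n : ℕ, 1 ≤ n → A * (n : ℝ) ^ (-(1 / k)) ≤ e n)
    (h2 : ∀ n : ℕ, 1 ≤ n → e n ≤ B * (n : ℝ) ^ (-(1 / k))) :
    Tendsto (fun n : ℕ => Real.log n / (- Real.log (e n))) atTop (nhds k) := by
  have hlog : Tendsto (fun n : ℕ => Real.log n) atTop atTop :=
    Real.tendsto_log_atTop.comp tendsto_natCast_atTop_atTop
  have hlim : ∀ C : ℝ, Tendsto (fun n : ℕ => 1 / k - Real.log C / Real.log n) atTop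
      (nhds (1 / k)) := by
    intro C
    have := (tendsto_const_nhds (x := Real.log C)).div_atTop hlog
    simpa using (tendsto_const_nhds (x := 1 / k)).sub this
  have hmain : Tendsto (fun n : ℕ => (- Real.log (e n)) / Real.log n) atTop (nhds (1 / k)) := by
    refine tendsto_of_tendsto_of_tendsto_of_le_of_le' (hlim B) (hlim A) ?_ ?_
    · filter_upwards [eventually_ge_atTop 2] with n hn
      have hn0 : (0 : ℝ) < n := by exact_mod_cast (by omega : 0 < n)
      have hl : 0 < Real.log n := Real.log_pos (by exact_mod_cast (by omega : 1 < n))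
      have hp : (0 : ℝ) < (n : ℝ) ^ (-(1 / k)) := by positivity
      have he : 0 < e n := (mul_pos hA hp).trans_le (h1 n (by omega))
      have := Real.log_le_log he (h2 n (by omega))
      rw [Real.log_mul hB.ne' hp.ne', Real.log_rpow hn0] at this
      rw [le_div_iff₀ hl, sub_mul, div_mul_cancel₀ _ hl.ne']
      linarith
    · filter_upwards [eventually_ge_atTop 2] with n hn
      have hn0 : (0 : ℝ) < n := by exact_mod_cast (by omega : 0 < n)
      have hl : 0 < Real.log n := Real.log_pos (by exact_mod_cast (by omega : 1 < n))
      have hp : (0 : ℝ) < (n : ℝ) ^ (-(1 / k)) := by positivity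
      have := Real.log_le_log (mul_pos hA hp) (h1 n (by omega))
      rw [Real.log_mul hA.ne' hp.ne', Real.log_rpow hn0] at this
      rw [div_le_iff₀ hl, sub_mul, div_mul_cancel₀ _ hl.ne']
      linarith
  have := hmain.inv₀ (by positivity)
  simpa using this

end GrafLus

/-- Graf–Luschgy: for a self-similar measure `P` associated with contractive
similitudes `(S_i)` satisfying the open set condition and a positive probability vector `(p_i)`,
and `k_r > 0` the solution of `Σ (p_i s_i^r)^{k_r/(k_r+r)} = 1`, one has
`0 < Q̲_r^{k_r}(P) ≤ Q̄_r^{k_r}(P) < ∞`; in particular `D_r(P)` exists and equals `k_r`. -/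
theorem graf_luschgy_self_similar (q N : ℕ) (hN : 1 ≤ N)
    (S : Fin N → EuclideanSpace ℝ (Fin q) → EuclideanSpace ℝ (Fin q))
    (c : Fin N → ℝ) (hc : ∀ i, 0 < c i ∧ c i < 1)
    (hsim : ∀ i x y, dist (S i x) (S i y) = c i * dist x y)
    (hOSC : ∃ U : Set (EuclideanSpace ℝ (Fin q)), U.Nonempty ∧ IsOpen U ∧
      (∀ i, S i '' U ⊆ U) ∧ ∀ i j, i ≠ j → Disjoint (S i '' U) (S j '' U))
    (p : Fin N → ℝ) (hp : ∀ i, 0 < p i) (hp1 : ∑ i, p i = 1)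
    (P : Measure (EuclideanSpace ℝ (Fin q))) [IsProbabilityMeasure P]
    (hP : P = ∑ i, ENNReal.ofReal (p i) • P.map (S i))
    (r kr : ℝ) (hr : 0 < r) (hkr : 0 < kr)
    (hkreq : ∑ i, (p i * c i ^ r) ^ (kr / (kr + r)) = 1) :
    (0 < lowerQuantCoeff P r kr ∧ lowerQuantCoeff P r kr ≤ upperQuantCoeff P r kr ∧
      upperQuantCoeff P r kr < ∞) ∧
    upperQuantDim P r = kr ∧ lowerQuantDim P r = kr := by
  have hc0 : ∀ i, 0 < c i := fun i => (hc i).1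
  have hc1 : ∀ i, c i < 1 := fun i => (hc i).2
  have : Nonempty (Fin N) := ⟨⟨0, hN⟩⟩
  set t : Fin N → ℝ := fun i => (p i * c i ^ r) ^ (kr / (kr + r)) with ht
  have htp : ∀ i, 0 < t i := fun i => by
    have := hp i; have := hc0 i; simp only [ht]; positivity
  have ht1 : ∀ i, t i < 1 := fun i => by
    have h1 := hp i; have h2 := hc0 i
    have h3 : p i ≤ 1 := hp1 ▸ Finset.single_le_sum (fun j _ => (hp j).le) (Finset.mem_univ i)
    have h4 : c i ^ r < 1 := Real.rpow_lt_one h2.le (hc1 i) hr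
    have h5 : 0 < c i ^ r := by positivity
    exact Real.rpow_lt_one (by positivity) (by nlinarith) (by positivity)
  obtain ⟨i1, hi1⟩ := Finite.exists_min c
  obtain ⟨i2, hi2⟩ := Finite.exists_max c
  obtain ⟨i3, hi3⟩ := Finite.exists_min t
  obtain ⟨i4, hi4⟩ := Finite.exists_max t
  have hsurj : ∀ i, Function.Surjective (S i) := fun i =>
    GrafLus.sim_surj (S i) (c i) (hc0 i) (hsim i)
  obtain ⟨U, hUne, hUo, hU, hUd⟩ := hOSC
  have hU' : ∀ i, ∀ x ∈ U, S i x ∈ U := fun i x hx => hU i ⟨x, hx, rfl⟩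
  have hUd' : ∀ i j, i ≠ j → ∀ x ∈ U, ∀ y ∈ U, S i x ≠ S j y := fun i j hij x hx y hy h =>
    Set.disjoint_left.1 (hUd i j hij) ⟨x, hx, rfl⟩ ⟨y, hy, h.symm⟩
  obtain ⟨R, hR0, hR, hPR⟩ := GrafLus.ball_exists S c hc0 hsim (c i2) hi2 (hc0 i2) (hc1 i2)
    p hp hp1 P hP
  obtain ⟨K, hKc, hKR, hKS, hKad, hPK⟩ := GrafLus.attractor S c hc0 hsim p P hP R hR hPR
  obtain ⟨σ, hσ⟩ := GrafLus.sosc S c hc0 hc1 hsim hsurj U hUne hUo hU' hUd' K 0 R hKR hKad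
    (c i1) (c i2) (hc0 i1) hi1 hi2 (hc0 i2).le (hc1 i2)
  obtain ⟨B, hB, hup⟩ := GrafLus.upper S c hc0 hsim p t hp P hP r kr hr hkr (fun _ => rfl) hkreq
    R hR0 hPR (t i3) (t i4) (htp i3) hi3 hi4 (htp i4).le (ht1 i4)
  obtain ⟨A, hA, hlo⟩ := GrafLus.lower S c hc0 hsim p t hp P hP r kr hr hkr (fun _ => rfl) hkreq
    R hPR (t i3) (t i4) (htp i3) (ht1 i3).le hi3 hi4 (htp i4).le (ht1 i4) K hKc hKS hPK σ hσ
  have hpow : ∀ (C : ℝ), 0 < C → ∀ n : ℕ, (C * (n : ℝ) ^ (-(r / kr))) ^ (1 / r)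
      = C ^ (1 / r) * (n : ℝ) ^ (-(1 / kr)) := by
    intro C hC n
    rw [Real.mul_rpow hC.le (by positivity), ← Real.rpow_mul (by positivity)]
    congr 2
    field_simp
  have hint0 : ∀ α : Finset (EuclideanSpace ℝ (Fin q)),
      0 ≤ ∫ x, infDist x (↑α : Set (EuclideanSpace ℝ (Fin q))) ^ r ∂P := fun α =>
    integral_nonneg fun x => Real.rpow_nonneg infDist_nonneg _
  have h1 : ∀ n : ℕ, 1 ≤ n → A ^ (1 / r) * (n : ℝ) ^ (-(1 / kr)) ≤ quantError P r n := by
    intro n hn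
    refine le_csInf ⟨_, {0}, by simp, by simpa using hn, rfl⟩ ?_
    rintro _ ⟨α, h1, h2, rfl⟩
    rw [← hpow A hA n]
    exact Real.rpow_le_rpow (by positivity) (hlo n hn α h1 h2) (by positivity)
  have h2 : ∀ n : ℕ, 1 ≤ n → quantError P r n ≤ B ^ (1 / r) * (n : ℝ) ^ (-(1 / kr)) := by
    intro n hn
    obtain ⟨α, h1, h2, h3⟩ := hup n hn
    unfold quantError
    refine le_trans (csInf_le ⟨0, ?_⟩ (Set.mem_setOf.2 ⟨α, h1, h2, rfl⟩)) ?_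
    · rintro _ ⟨α, _, _, rfl⟩
      exact Real.rpow_nonneg (hint0 α) _
    · rw [← hpow B hB n]
      exact Real.rpow_le_rpow (hint0 α) h3 (by positivity)
  have hA' : 0 < A ^ (1 / r) := by positivity
  have hB' : 0 < B ^ (1 / r) := by positivity
  have hlim := GrafLus.asympt (quantError P r) kr _ _ hkr hA' hB' h1 h2
  have hcancel : ∀ n : ℕ, 1 ≤ n → (n : ℝ) ^ (1 / kr) * (n : ℝ) ^ (-(1 / kr)) = 1 := by
    intro n hn
    have hn0 : (0 : ℝ) < n := by exact_mod_cast hn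
    rw [← Real.rpow_add hn0]
    simp
  refine ⟨⟨?_, ?_, ?_⟩, hlim.limsup_eq, hlim.liminf_eq⟩
  · refine lt_of_lt_of_le (ENNReal.ofReal_pos.2 hA') ?_
    refine le_liminf_of_le (by isBoundedDefault) ?_
    filter_upwards [eventually_ge_atTop 1] with n hn
    refine ENNReal.ofReal_le_ofReal ?_
    have := mul_le_mul_of_nonneg_left (h1 n hn) (Real.rpow_nonneg (Nat.cast_nonneg n) (1 / kr))
    rwa [mul_left_comm, hcancel n hn, mul_one] at this
  · exact liminf_le_limsup
  · refine lt_of_le_of_lt ?_ (ENNReal.ofReal_lt_top (r := B ^ (1 / r)))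
    refine limsup_le_of_le (by isBoundedDefault) ?_
    filter_upwards [eventually_ge_atTop 1] with n hn
    refine ENNReal.ofReal_le_ofReal ?_
    have := mul_le_mul_of_nonneg_left (h2 n hn) (Real.rpow_nonneg (Nat.cast_nonneg n) (1 / kr))
    rwa [mul_left_comm, hcancel n hn, mul_one] at this
end

section
/- For every r ∈ [1,∞) there exists a compactly supported Borel probability measure μ on ℝ^q such that D̲_r(μ) does not coincide with its finitely stabilized counterpart inf { max_{1≤i≤n} D̲_r(μ_i) : n ∈ ℕ, μ = Σ_{i=1}^n s_i μ_i with s_i > 0 and each μ_i a compactly supported Borel probability measure on ℝ^q }; in other words, the lower quantization dimension is not finitely stable. -/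
open MeasureTheory Filter Metric
open scoped ENNReal NNReal

namespace QD

set_option linter.unusedSectionVars false

/-- exponents -/
def L (k : ℕ) : ℕ := 16 ^ k
/-- number of grid points at level `k` -/
def N (k : ℕ) : ℕ := 2 ^ L k

lemma L_succ (k : ℕ) : L (k + 1) = 16 * L k := by simp [L, pow_succ, mul_comm]
lemma L_pos (k : ℕ) : 0 < L k := by simp [L]
lemma L_mono : StrictMono L := strictMono_nat_of_lt_succ (fun k => by
  rw [L_succ]; have := L_pos k; omega)
lemma N_pos (k : ℕ) : 0 < N k := by simp [N]
lemma N_dvd {j k : ℕ} (h : j ≤ k) : N j ∣ N k := pow_dvd_pow _ (L_mono.monotone h)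
lemma L_tendsto : Tendsto L atTop atTop := L_mono.tendsto_atTop
lemma N_tendsto : Tendsto N atTop atTop :=
  (tendsto_pow_atTop_atTop_of_one_lt (by norm_num : (1:ℕ) < 2)).comp L_tendsto

variable {E : Type*} [NormedAddCommGroup E] [NormedSpace ℝ E] [MeasurableSpace E]

/-- grid points -/
noncomputable def pt (u : E) (k i : ℕ) : E := ((i : ℝ) / (N k : ℝ)) • u

/-- atom weight -/
noncomputable def v (R k : ℕ) : ℝ≥0∞ := (2⁻¹ : ℝ≥0∞) ^ ((R + 1) * L k)
/-- level weight -/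
noncomputable def w (R k : ℕ) : ℝ≥0∞ := (2⁻¹ : ℝ≥0∞) ^ (R * L k)

lemma N_mul_v (R k : ℕ) : (N k : ℝ≥0∞) * v R k = w R k := by
  unfold v w N
  rw [add_mul, one_mul, pow_add, mul_comm, mul_assoc]
  push_cast
  rw [← mul_pow, ENNReal.inv_mul_cancel (by norm_num) (by norm_num), one_pow, mul_one]

/-- level measure -/
noncomputable def U (u : E) (R k : ℕ) : Measure E :=
  ∑ i ∈ Finset.range (N k), v R k • Measure.dirac (pt u k i)

/-- unnormalized measure -/
noncomputable def M (u : E) (R : ℕ) (g : ℕ → ℕ) : Measure E :=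
  Measure.sum fun j => U u R (g j)

open Classical in
/-- grid as a finset -/
noncomputable def grid (u : E) (k : ℕ) : Finset E := (Finset.range (N k)).image (pt u k)

lemma grid_card (u : E) (k : ℕ) : (grid u k).card ≤ N k := by
  classical
  unfold grid
  exact Finset.card_image_le.trans (by simp)

lemma zero_mem_grid (u : E) (k : ℕ) : (0 : E) ∈ grid u k := by
  classical
  unfold grid
  exact Finset.mem_image.2 ⟨0, by simpa using N_pos k, by simp [pt]⟩

lemma pt_mem_grid (u : E) {j k i : ℕ} (h : j ≤ k) (hi : i < N j) : pt u j i ∈ grid u k := by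
  classical
  unfold grid
  obtain ⟨d, hd⟩ := N_dvd h
  have hk := N_pos k
  have hj := N_pos j
  have hd0 : 0 < d := by
    rcases Nat.eq_zero_or_pos d with h0 | h0
    · rw [h0] at hd; omega
    · exact h0
  refine Finset.mem_image.2 ⟨i * d, ?_, ?_⟩
  · simp only [Finset.mem_range]; rw [hd]; exact Nat.mul_lt_mul_of_pos_right hi hd0
  · unfold pt
    rw [hd]
    have : (d : ℝ) ≠ 0 := by positivity
    have : (N j : ℝ) ≠ 0 := by positivity
    congr 1
    push_cast
    field_simp

lemma norm_pt_le {u : E} (hu : ‖u‖ = 1) {k i : ℕ} (hi : i < N k) : ‖pt u k i‖ ≤ 1 := by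
  unfold pt
  have : (0:ℝ) < N k := by exact_mod_cast N_pos k
  have h2 : (i:ℝ) ≤ N k := by exact_mod_cast hi.le
  rw [norm_smul, hu, mul_one, Real.norm_of_nonneg (by positivity)]
  rwa [div_le_one this]

lemma U_apply (u : E) (R k : ℕ) {s : Set E} (hs : MeasurableSet s) :
    U u R k s = ∑ i ∈ Finset.range (N k), v R k * s.indicator 1 (pt u k i) := by
  unfold U
  simp [Measure.finsetSum_apply, Measure.dirac_apply' _ hs]

lemma U_le (u : E) (R k : ℕ) {s : Set E} (hs : MeasurableSet s) : U u R k s ≤ w R k := by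
  rw [U_apply u R k hs, ← N_mul_v]
  calc _ ≤ ∑ i ∈ Finset.range (N k), v R k := by
        refine Finset.sum_le_sum fun i _ => ?_
        calc _ ≤ v R k * 1 := by
              gcongr
              exact Set.indicator_le_self' (by simp) _ 
          _ = _ := mul_one _
    _ = _ := by simp

lemma U_zero (u : E) (R k : ℕ) {s : Set E} (hs : MeasurableSet s)
    (h : ∀ i < N k, pt u k i ∉ s) : U u R k s = 0 := by
  rw [U_apply u R k hs]
  refine Finset.sum_eq_zero fun i hi => ?_
  rw [Set.indicator_of_notMem (h i (Finset.mem_range.1 hi)), mul_zero]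

lemma le_U (u : E) (R k : ℕ) {s : Set E} (hs : MeasurableSet s) {i : ℕ} (hi : i < N k)
    (h : pt u k i ∈ s) : v R k ≤ U u R k s := by
  rw [U_apply u R k hs]
  refine le_trans ?_ (Finset.single_le_sum (f := fun i => v R k * s.indicator 1 (pt u k i))
    (fun _ _ => zero_le) (Finset.mem_range.2 hi))
  simp [Set.indicator_of_mem h]

lemma w_tail (R : ℕ) (hR : 1 ≤ R) {g : ℕ → ℕ} (hg : StrictMono g) (m : ℕ) :
    ∑' i, w R (g (m + i)) ≤ 2 * w R (g m) := by
  have key : ∀ i, w R (g (m + i)) ≤ w R (g m) * (2⁻¹ : ℝ≥0∞) ^ i := by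
    intro i
    unfold w
    rw [← pow_add]
    apply pow_le_pow_of_le_one zero_le (by simp)
    have h1 : L (g m) + i ≤ L (g (m + i)) := by
      have := (L_mono.comp hg).add_le_nat i m
      simpa [add_comm] using this
    nlinarith
  calc _ ≤ ∑' i, w R (g m) * (2⁻¹ : ℝ≥0∞) ^ i := ENNReal.tsum_le_tsum key
    _ = _ := by
      rw [ENNReal.tsum_mul_left, ENNReal.tsum_geometric, ENNReal.one_sub_inv_two, inv_inv, mul_comm]

lemma M_apply (u : E) (R : ℕ) (g : ℕ → ℕ) {s : Set E} (hs : MeasurableSet s) :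
    M u R g s = ∑' j, U u R (g j) s := Measure.sum_apply _ hs

lemma M_univ_le (u : E) (R : ℕ) (hR : 1 ≤ R) {g : ℕ → ℕ} (hg : StrictMono g) :
    M u R g Set.univ ≤ 2 * w R (g 0) := by
  rw [M_apply u R g MeasurableSet.univ]
  refine (ENNReal.tsum_le_tsum fun j => U_le u R (g j) MeasurableSet.univ).trans ?_
  simpa using w_tail R hR hg 0

lemma w_ne_top (R k : ℕ) : w R k ≠ ⊤ := ENNReal.pow_ne_top (by simp)
lemma v_ne_top (R k : ℕ) : v R k ≠ ⊤ := ENNReal.pow_ne_top (by simp)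
lemma v_pos (R k : ℕ) : v R k ≠ 0 := by simp [v]

lemma M_univ_ne_top (u : E) (R : ℕ) (hR : 1 ≤ R) {g : ℕ → ℕ} (hg : StrictMono g) :
    M u R g Set.univ ≠ ⊤ :=
  ne_top_of_le_ne_top (ENNReal.mul_ne_top (by simp) (w_ne_top _ _)) (M_univ_le u R hR hg)

lemma le_M (u : E) (R j : ℕ) (g : ℕ → ℕ) {s : Set E} (hs : MeasurableSet s) {i : ℕ}
    (hi : i < N (g j)) (h : pt u (g j) i ∈ s) : v R (g j) ≤ M u R g s := by
  rw [M_apply u R g hs]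
  exact (le_U u R (g j) hs hi h).trans (ENNReal.le_tsum j)

lemma M_univ_ne_zero (u : E) (R : ℕ) (g : ℕ → ℕ) : M u R g Set.univ ≠ 0 := by
  intro h
  have := le_M u R 0 g MeasurableSet.univ (N_pos _) (Set.mem_univ _)
  rw [h] at this
  exact v_pos R (g 0) (le_antisymm this zero_le)

lemma M_grid [BorelSpace E] (u : E) (R : ℕ) (hR : 1 ≤ R) {g : ℕ → ℕ} (hg : StrictMono g) (m : ℕ) :
    M u R g (↑(grid u (g m)) : Set E)ᶜ ≤ 2 * w R (g (m + 1)) := by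
  have hs : MeasurableSet (↑(grid u (g m)) : Set E)ᶜ := (Finset.measurableSet _).compl
  rw [M_apply u R g hs, ← ENNReal.summable.sum_add_tsum_nat_add' (k := m + 1)]
  rw [Finset.sum_eq_zero, zero_add]
  · refine (ENNReal.tsum_le_tsum fun j => U_le u R _ hs).trans ?_
    refine le_trans (le_of_eq ?_) (w_tail R hR hg (m + 1))
    refine tsum_congr fun i => ?_
    rw [add_comm i]
  · intro j hj
    apply U_zero u R _ hs
    intro i hi hmem
    exact hmem (by
      exact_mod_cast pt_mem_grid u (hg.monotone (Nat.lt_succ_iff.1 (Finset.mem_range.1 hj))) hi)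

lemma M_ball [BorelSpace E] {u : E} (hu : ‖u‖ = 1) (R : ℕ) (g : ℕ → ℕ) :
    M u R g (closedBall (0:E) 1)ᶜ = 0 := by
  have hs : MeasurableSet (closedBall (0:E) 1)ᶜ := measurableSet_closedBall.compl
  rw [M_apply u R g hs]
  simp only [ENNReal.tsum_eq_zero]
  intro j
  apply U_zero u R _ hs
  intro i hi hmem
  exact hmem (by simpa using norm_pt_le hu hi)

/-- normalized measure -/
noncomputable def P (u : E) (R : ℕ) (g : ℕ → ℕ) : Measure E :=
  (M u R g Set.univ)⁻¹ • M u R g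

lemma P_prob (u : E) (R : ℕ) (hR : 1 ≤ R) {g : ℕ → ℕ} (hg : StrictMono g) :
    IsProbabilityMeasure (P u R g) := ⟨by
  unfold P
  rw [Measure.smul_apply, smul_eq_mul,
    ENNReal.inv_mul_cancel (M_univ_ne_zero u R g) (M_univ_ne_top u R hR hg)]⟩

lemma P_ball [BorelSpace E] {u : E} (hu : ‖u‖ = 1) (R : ℕ) (g : ℕ → ℕ) :
    P u R g (closedBall (0:E) 1)ᶜ = 0 := by
  unfold P
  rw [Measure.smul_apply, M_ball hu]; simp

lemma M_split (u : E) (R : ℕ) :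
    M u R id = M u R (fun j => 2 * j) + M u R (fun j => 2 * j + 1) := by
  ext s hs
  rw [Measure.add_apply, M_apply _ _ _ hs, M_apply _ _ _ hs, M_apply _ _ _ hs]
  exact (tsum_even_add_odd (f := fun j => U u R j s) ENNReal.summable ENNReal.summable).symm

lemma smul_P (u : E) (R : ℕ) (hR : 1 ≤ R) {g : ℕ → ℕ} (hg : StrictMono g) :
    M u R g = M u R g Set.univ • P u R g := by
  unfold P
  rw [smul_smul, ENNReal.mul_inv_cancel (M_univ_ne_zero u R g) (M_univ_ne_top u R hR hg), one_smul]

lemma w_toReal (R k : ℕ) : (w R k).toReal = (2⁻¹ : ℝ) ^ (R * L k) := by simp [w]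
lemma v_toReal (R k : ℕ) : (v R k).toReal = (2⁻¹ : ℝ) ^ ((R + 1) * L k) := by simp [v]

lemma P_grid [BorelSpace E] (u : E) (R : ℕ) (hR : 1 ≤ R) {g : ℕ → ℕ} (hg : StrictMono g) :
    ∃ C : ℝ, 0 < C ∧ ∀ m, (P u R g).real (↑(grid u (g m)) : Set E)ᶜ
      ≤ C * (2⁻¹ : ℝ) ^ (R * L (g (m + 1))) := by
  have h0 := M_univ_ne_zero u R g
  have h1 := M_univ_ne_top u R hR hg
  refine ⟨((M u R g Set.univ)⁻¹ * 2).toReal, ENNReal.toReal_pos (by simp [h1])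
    (ENNReal.mul_ne_top (by simp [h0]) (by simp)), fun m => ?_⟩
  rw [← w_toReal, ← ENNReal.toReal_mul]
  refine ENNReal.toReal_mono (ENNReal.mul_ne_top (ENNReal.mul_ne_top (by simp [h0]) (by simp))
    (w_ne_top _ _)) ?_
  unfold P
  rw [Measure.smul_apply, smul_eq_mul, mul_assoc]
  gcongr
  exact M_grid u R hR hg m

lemma P_atom [BorelSpace E] (u : E) (R : ℕ) (hR : 1 ≤ R) :
    ∃ c : ℝ, 0 < c ∧ ∀ k i, i < N k → ∀ s : Set E, MeasurableSet s → pt u k i ∈ s →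
      c * (2⁻¹ : ℝ) ^ ((R + 1) * L k) ≤ (P u R id).real s := by
  have h0 := M_univ_ne_zero u R id
  have h1 := M_univ_ne_top u R hR strictMono_id
  refine ⟨((M u R id Set.univ)⁻¹).toReal, ENNReal.toReal_pos (by simp [h1])
    (by simp [h0]), fun k i hi s hs hmem => ?_⟩
  have := P_prob u R hR strictMono_id
  rw [← v_toReal, ← ENNReal.toReal_mul]
  refine ENNReal.toReal_mono (measure_ne_top _ _) ?_
  unfold P
  rw [Measure.smul_apply, smul_eq_mul]
  gcongr
  exact le_M u R k id hs hi hmem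

/-! quantization error -/

lemma err_bdd (Q : Measure E) (r : ℝ) (n : ℕ) : BddBelow {e : ℝ | ∃ α : Finset E, 1 ≤ α.card ∧
    α.card ≤ n ∧ e = (∫ x, infDist x (↑α : Set E) ^ r ∂Q) ^ (1 / r)} := by
  refine ⟨0, ?_⟩
  rintro e ⟨α, -, -, rfl⟩
  exact Real.rpow_nonneg (integral_nonneg fun x => Real.rpow_nonneg infDist_nonneg _) _

lemma err_nonneg (Q : Measure E) (r : ℝ) (n : ℕ) : 0 ≤ quantError Q r n := by
  refine Real.sInf_nonneg ?_
  rintro e ⟨α, -, -, rfl⟩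
  exact Real.rpow_nonneg (integral_nonneg fun x => Real.rpow_nonneg infDist_nonneg _) _

lemma integrable_infDist [BorelSpace E] [ProperSpace E] (Q : Measure E) [IsProbabilityMeasure Q]
    (hQ : Q (closedBall (0:E) 1)ᶜ = 0) {r : ℝ} (hr : 1 ≤ r) (s : Set E) :
    Integrable (fun x => infDist x s ^ r) Q := by
  have hc : Continuous (fun x => infDist x s ^ r) :=
    (continuous_infDist_pt s).rpow_const fun x => Or.inr (by linarith)
  have := hc.continuousOn.integrableOn_compact (μ := Q) (isCompact_closedBall (0:E) 1)
  rwa [IntegrableOn, Measure.restrict_eq_self_of_ae_mem] at this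
  exact hQ

lemma err_le [BorelSpace E] [ProperSpace E] (Q : Measure E) [IsProbabilityMeasure Q]
    (hQ : Q (closedBall (0:E) 1)ᶜ = 0) {r : ℝ} (hr : 1 ≤ r) {n : ℕ} {α : Finset E}
    (h0 : (0:E) ∈ α) (hn : α.card ≤ n) :
    quantError Q r n ≤ Q.real (↑α : Set E)ᶜ ^ (1 / r) := by
  have hs : MeasurableSet (↑α : Set E)ᶜ := (Finset.measurableSet _).compl
  refine (csInf_le (err_bdd Q r n) ⟨α, Finset.card_pos.2 ⟨0, h0⟩, hn, rfl⟩).trans ?_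
  refine Real.rpow_le_rpow (integral_nonneg fun x => Real.rpow_nonneg infDist_nonneg _) ?_
    (by positivity)
  rw [← integral_indicator_one hs]
  refine integral_mono_ae (integrable_infDist Q hQ hr _)
    ((integrable_const (1:ℝ)).indicator hs) ?_
  have hae : ∀ᵐ x ∂Q, x ∈ closedBall (0:E) 1 := hQ
  filter_upwards [hae] with x hx
  by_cases hxa : x ∈ (↑α : Set E)
  · rw [Set.indicator_of_notMem (by simpa using hxa), infDist_zero_of_mem hxa,
      Real.zero_rpow (by linarith)]
  · rw [Set.indicator_of_mem (by simpa using hxa)]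
    refine Real.rpow_le_one infDist_nonneg ?_ (by linarith)
    exact (infDist_le_dist_of_mem (y := 0) (by simpa using h0)).trans hx

lemma far_pt {u : E} (hu : ‖u‖ = 1) {k : ℕ} {α : Finset E} (h1 : 1 ≤ α.card)
    (h : α.card < N k) : ∃ i < N k, 1 / (2 * (N k : ℝ)) ≤ infDist (pt u k i) (↑α : Set E) := by
  by_contra! hcon
  have hne : (↑α : Set E).Nonempty := by simpa using Finset.card_pos.1 h1
  have : ∀ i, ∃ y, i < N k → y ∈ α ∧ dist (pt u k i) y < 1 / (2 * (N k : ℝ)) := by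
    intro i
    by_cases hi : i < N k
    · obtain ⟨y, hy, hd⟩ := (infDist_lt_iff hne).1 (hcon i hi)
      exact ⟨y, fun _ => ⟨by simpa using hy, hd⟩⟩
    · exact ⟨0, fun h => absurd h hi⟩
  choose f hf using this
  obtain ⟨i, hi, j, hj, hij, he⟩ := Finset.exists_ne_map_eq_of_card_lt_of_maps_to
    (s := Finset.range (N k)) (t := α) (by simpa using h) (f := f)
    (fun i hi => (hf i (by simpa using hi)).1)
  have d1 := (hf i (by simpa using hi)).2
  have d2 := (hf j (by simpa using hj)).2
  rw [← he] at d2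
  have d3 := dist_triangle_right (pt u k i) (pt u k j) (f i)
  have hN : (0:ℝ) < N k := by exact_mod_cast N_pos k
  have d4 : dist (pt u k i) (pt u k j) = |(i:ℝ) - j| / N k := by
    unfold pt
    rw [dist_eq_norm, ← sub_smul, norm_smul, hu, mul_one, ← sub_div, Real.norm_eq_abs, abs_div,
      abs_of_pos hN]
  have d5 : (1:ℝ) ≤ |(i:ℝ) - j| := by
    have : (1:ℤ) ≤ |(i:ℤ) - j| := Int.one_le_abs (by omega)
    exact_mod_cast this
  have d6 : 1 / (N k : ℝ) ≤ |(i:ℝ) - j| / N k := by gcongr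
  have d7 : 1 / (2 * (N k : ℝ)) + 1 / (2 * (N k : ℝ)) = 1 / N k := by field_simp; norm_num
  linarith

lemma le_err [BorelSpace E] [ProperSpace E] {u : E} (hu : ‖u‖ = 1) {R : ℕ} (hR : 1 ≤ R)
    {r : ℝ} (hr : 1 ≤ r) :
    ∃ c : ℝ, 0 < c ∧ ∀ k n, 1 ≤ n → n < N k →
      ((1 / (2 * (N k : ℝ))) ^ r * (c * (2⁻¹ : ℝ) ^ ((R + 1) * L k))) ^ (1 / r) 
        ≤ quantError (P u R id) r n := by
  obtain ⟨c, hc, h⟩ := P_atom u R hR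
  have := P_prob u R hR strictMono_id
  refine ⟨c, hc, fun k n h1 hn => ?_⟩
  refine le_csInf ⟨_, {0}, by simp, by simpa using h1, rfl⟩ ?_
  rintro e ⟨α, ha1, han, rfl⟩
  obtain ⟨i, hi, hfar⟩ := far_pt hu ha1 (han.trans_lt hn)
  refine Real.rpow_le_rpow (by positivity) ?_ (by positivity)
  refine le_trans ?_ (mul_meas_ge_le_integral_of_nonneg (ε := (1 / (2 * (N k : ℝ))) ^ r)
    (ae_of_all _ fun x => Real.rpow_nonneg infDist_nonneg _)
    (integrable_infDist (P u R id) (P_ball hu R id) hr (↑α : Set E)))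
  refine mul_le_mul_of_nonneg_left ?_ (by positivity)
  refine h k i hi _ ?_ ?_
  · refine measurableSet_le measurable_const ?_
    exact ((continuous_infDist_pt _).rpow_const fun x => Or.inr (by linarith)).measurable
  · exact Real.rpow_le_rpow (by positivity) hfar (by linarith)

lemma err_le_one [BorelSpace E] [ProperSpace E] (Q : Measure E) [IsProbabilityMeasure Q]
    (hQ : Q (closedBall (0:E) 1)ᶜ = 0) {r : ℝ} (hr : 1 ≤ r) {n : ℕ} (hn : 1 ≤ n) :
    quantError Q r n ≤ 1 :=
  (err_le Q hQ hr (α := {0}) (by simp) (by simpa using hn)).trans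
    (Real.rpow_le_one (by positivity) measureReal_le_one (by positivity))

lemma ratio_nonneg [BorelSpace E] [ProperSpace E] (Q : Measure E) [IsProbabilityMeasure Q]
    (hQ : Q (closedBall (0:E) 1)ᶜ = 0) {r : ℝ} (hr : 1 ≤ r) (n : ℕ) :
    0 ≤ Real.log n / (- Real.log (quantError Q r n)) := by
  rcases Nat.eq_zero_or_pos n with rfl | hn
  · simp
  · have := Real.log_nonpos (err_nonneg Q r n) (err_le_one Q hQ hr hn)
    exact div_nonneg (Real.log_natCast_nonneg n) (by linarith)

lemma freq [BorelSpace E] [ProperSpace E] {u : E} (hu : ‖u‖ = 1) {R : ℕ}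
    {r : ℝ} (hr : 1 ≤ r) (hR : r ≤ R) {g : ℕ → ℕ} (hg : StrictMono g) (D : ℕ) (hD : 0 < D)
    (hgD : ∀ m, L (g (m + 1)) = D * L (g m)) :
    ∃ᶠ n : ℕ in atTop, Real.log n / (- Real.log (quantError (P u R g) r n)) ≤ 2 / D := by
  have hR1 : 1 ≤ R := by exact_mod_cast hr.trans hR
  obtain ⟨C, hC, h⟩ := P_grid u R hR1 hg
  have := P_prob u R hR1 hg
  have hlog2 : 0 < Real.log 2 := Real.log_pos (by norm_num)
  have hT : Tendsto (fun m => N (g m)) atTop atTop := N_tendsto.comp hg.tendsto_atTop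
  refine hT.frequently (Eventually.frequently ?_)
  have hL : Tendsto (fun m => ((L (g (m + 1)) : ℕ) : ℝ)) atTop atTop :=
    tendsto_natCast_atTop_atTop.comp
      (L_tendsto.comp (hg.tendsto_atTop.comp (tendsto_add_atTop_nat 1)))
  filter_upwards [hL.eventually_ge_atTop (2 * |Real.log C| / Real.log 2)] with m hm
  set e := quantError (P u R g) r (N (g m)) with he
  have e0 : 0 ≤ e := err_nonneg _ _ _
  rcases e0.eq_or_lt with e0 | e0
  · rw [← e0, Real.log_zero, neg_zero, div_zero]; positivity
  have e1 : e ≤ (C * (2⁻¹ : ℝ) ^ (R * L (g (m + 1)))) ^ (1 / r) :=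
    (err_le (P u R g) (P_ball hu R g) hr (zero_mem_grid u (g m)) (grid_card u (g m))).trans
      (Real.rpow_le_rpow (by positivity) (h m) (by positivity))
  have e2 := Real.log_le_log e0 e1
  rw [Real.log_rpow (by positivity), Real.log_mul (by positivity) (by positivity), Real.log_pow,
    Real.log_inv] at e2
  set L' : ℝ := ((L (g (m + 1)) : ℕ) : ℝ) with hL'
  have hL'0 : 0 < L' := by rw [hL']; exact_mod_cast L_pos _
  push_cast at e2
  have hr0 : 0 < r := by linarith
  rw [one_div, inv_mul_eq_div, le_div_iff₀ hr0] at e2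
  rw [div_le_iff₀ hlog2] at hm
  have hlow : L' / 2 * Real.log 2 ≤ - Real.log e := by
    have a1 := le_abs_self (Real.log C)
    have a2 : r * (L' * Real.log 2) ≤ R * (L' * Real.log 2) := by gcongr
    have a3 : |Real.log C| ≤ r * |Real.log C| := le_mul_of_one_le_left (abs_nonneg _) hr
    have a4 : r * (2 * |Real.log C|) ≤ r * (L' * Real.log 2) := by gcongr
    have : r * (L' / 2 * Real.log 2) ≤ r * (- Real.log e) := by nlinarith
    exact le_of_mul_le_mul_left this hr0
  have hpos : 0 < L' / 2 * Real.log 2 := by positivity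
  rw [div_le_div_iff₀ (by linarith) (by exact_mod_cast hD)]
  have hn : Real.log (N (g m) : ℕ) = L (g m) * Real.log 2 := by simp [N]
  have hLD : L' = D * L (g m) := by rw [hL', hgD]; push_cast; ring
  rw [hn]
  rw [hLD] at hlow
  nlinarith

lemma even_le [BorelSpace E] [ProperSpace E] {u : E} (hu : ‖u‖ = 1) {R : ℕ}
    {r : ℝ} (hr : 1 ≤ r) (hR : r ≤ R) {g : ℕ → ℕ} (hg : StrictMono g) (D : ℕ) (hD : 0 < D)
    (hgD : ∀ m, L (g (m + 1)) = D * L (g m)) :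
    lowerQuantDim (P u R g) r ≤ 2 / D := by
  have := P_prob u R (by exact_mod_cast hr.trans hR) hg
  exact liminf_le_of_frequently_le (freq hu hr hR hg D hD hgD)
    ⟨0, eventually_map.2 (Eventually.of_forall fun n => ratio_nonneg _ (P_ball hu R g) hr n)⟩

lemma le_id [BorelSpace E] [ProperSpace E] {u : E} (hu : ‖u‖ = 1) {R : ℕ}
    {r : ℝ} (hr : 1 ≤ r) (hR : r ≤ R) (hR2 : (R : ℝ) ≤ r + 1) :
    1 / 80 ≤ lowerQuantDim (P u R id) r := by
  have hR1 : 1 ≤ R := by exact_mod_cast hr.trans hR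
  have := P_prob u R hR1 strictMono_id
  have hlog2 : 0 < Real.log 2 := Real.log_pos (by norm_num)
  refine le_liminf_of_le (IsCoboundedUnder.of_frequently_le (freq hu hr hR strictMono_id 16 (by norm_num) L_succ)) ?_
  obtain ⟨c, hc, h⟩ := le_err hu hR1 hr
  obtain ⟨c', hc', h'⟩ := P_atom u R hR1
  have hL : Tendsto (fun m => ((L m : ℕ) : ℝ)) atTop atTop :=
    tendsto_natCast_atTop_atTop.comp L_tendsto
  obtain ⟨K, hK⟩ := eventually_atTop.1
    (hL.eventually_ge_atTop ((|Real.log c| + Real.log 2) / Real.log 2))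
  filter_upwards [eventually_ge_atTop (N K)] with n hn
  have hn1 : 1 ≤ n := (N_pos K).trans_le hn
  -- find the level
  have hex : ∃ k, n < N k := (N_tendsto.eventually_gt_atTop n).exists
  classical
  obtain ⟨k, hk1, hk2⟩ : ∃ k, N k ≤ n ∧ n < N (k + 1) := by
    have hf := Nat.find_spec hex
    rcases hq : Nat.find hex with _ | k
    · rw [hq] at hf
      have : N 0 ≤ N K := Nat.pow_le_pow_right (by norm_num) (L_mono.monotone (Nat.zero_le _))
      omega
    · exact ⟨k, not_lt.1 (Nat.find_min hex (by omega)), by rwa [hq] at hf⟩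
  have hkK : K ≤ k + 1 := by
    by_contra! hlt
    have : N (k + 1) ≤ N K := Nat.pow_le_pow_right (by norm_num) (L_mono.monotone hlt.le)
    omega
  have hLk := hK (k + 1) hkK
  set e := quantError (P u R id) r n with he
  have elow := h (k + 1) n hn1 hk2
  have hNp : (0:ℝ) < N (k + 1) := by exact_mod_cast N_pos _
  have e0 : 0 < e := lt_of_lt_of_le (by positivity) elow
  have hr0 : 0 < r := by linarith
  have e1 : e < 1 := by
    refine (err_le (P u R id) (P_ball hu R id) hr (α := {0}) (by simp) (by simpa using hn1)).trans_lt ?_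
    refine Real.rpow_lt_one (by positivity) ?_ (by positivity)
    have := h' 0 0 (N_pos 0) {0} (measurableSet_singleton _) (by simp [pt])
    have hp : 0 < c' * (2⁻¹ : ℝ) ^ ((R + 1) * L 0) := by positivity
    simp only [Finset.coe_singleton]
    rw [probReal_compl_eq_one_sub (measurableSet_singleton _)]
    linarith
  have hneg : 0 < - Real.log e := by have := Real.log_neg e0 e1; linarith
  have e2 := Real.log_le_log (by positivity) elow
  have hNlog : Real.log (N (k + 1) : ℕ) = L (k + 1) * Real.log 2 := by simp [N]
  rw [Real.log_rpow (by positivity), Real.log_mul (by positivity) (by positivity),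
    Real.log_mul (by positivity) (by positivity), Real.log_pow,
    Real.log_rpow (by positivity), one_div (2 * (N (k + 1) : ℝ)), Real.log_inv, Real.log_inv,
    Real.log_mul (by norm_num) (by positivity), hNlog] at e2
  have hlogn : L k * Real.log 2 ≤ Real.log n := by
    have : Real.log (N k : ℕ) = L k * Real.log 2 := by simp [N]
    rw [← this]
    exact Real.log_le_log (by exact_mod_cast N_pos k) (by exact_mod_cast hk1)
  have hLs : (L (k + 1) : ℝ) = 16 * L k := by rw [L_succ]; push_cast; ring
  set l : ℝ := (L (k + 1) : ℝ) * Real.log 2 with hl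
  have hl0 : 0 ≤ l := by positivity
  push_cast at e2
  rw [one_div, inv_mul_eq_div, div_le_iff₀ hr0] at e2
  rw [div_le_iff₀ hlog2, ← hl] at hLk
  rw [le_div_iff₀ hneg]
  have hup : - Real.log e ≤ 5 * l := by
    have a1 := neg_abs_le (Real.log c)
    have a3 : |Real.log c| ≤ r * |Real.log c| := le_mul_of_one_le_left (abs_nonneg _) hr
    have a4 : (R + 1) * l ≤ (3 * r) * l := by gcongr; linarith
    have a5 : ((R : ℝ) + 1) * L (k + 1) * -Real.log 2 = - ((R + 1) * l) := by rw [hl]; ring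
    have a6 : r * (|Real.log c| + Real.log 2) ≤ r * l := by gcongr
    rw [a5] at e2
    have : r * (- Real.log e) ≤ r * (5 * l) := by nlinarith
    exact le_of_mul_le_mul_left this hr0
  rw [hLs] at hl
  nlinarith

end QD

/-- for every `r ∈ [1,∞)` (and `q ≥ 1`) there exists a compactly supported
Borel probability measure `μ` on `ℝ^q` whose lower quantization dimension of order `r` does
not coincide with its finitely stabilized counterpart
`inf { max_i D̲_r(μ_i) : μ = Σ_{i=1}^n s_i μ_i, s_i > 0, μ_i compactly supported }`. -/
theorem lowerQuantDim_not_finitely_stable (q : ℕ) (hq : 0 < q) (r : ℝ) (hr : 1 ≤ r) :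
    ∃ μ : Measure (EuclideanSpace ℝ (Fin q)), IsProbabilityMeasure μ ∧
      (∃ K : Set (EuclideanSpace ℝ (Fin q)), IsCompact K ∧ μ Kᶜ = 0) ∧
      lowerQuantDim μ r ≠ sInf {d : ℝ |
        ∃ (n : ℕ) (_ : 0 < n) (s : Fin n → ℝ)
          (ν : Fin n → Measure (EuclideanSpace ℝ (Fin q))),
          (∀ i, 0 < s i) ∧ (∀ i, IsProbabilityMeasure (ν i)) ∧
          (∀ i, ∃ Ki : Set (EuclideanSpace ℝ (Fin q)), IsCompact Ki ∧ ν i Kiᶜ = 0) ∧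
          μ = ∑ i, ENNReal.ofReal (s i) • ν i ∧
          d = ⨆ i, lowerQuantDim (ν i) r} := by
  have hR := Nat.le_ceil r
  have hR2 := (Nat.ceil_lt_add_one (by linarith : 0 ≤ r)).le
  set R := ⌈r⌉₊
  have hR1 : 1 ≤ R := by exact_mod_cast hr.trans hR
  let u : EuclideanSpace ℝ (Fin q) := EuclideanSpace.single ⟨0, hq⟩ 1
  have hu : ‖u‖ = 1 := by simp [u]
  have hg0 : StrictMono (fun j : ℕ => 2 * j) := fun a b h => by dsimp only; omega
  have hg1 : StrictMono (fun j : ℕ => 2 * j + 1) := fun a b h => by dsimp only; omega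
  have i0 := QD.P_prob u R hR1 hg0
  have i1 := QD.P_prob u R hR1 hg1
  have b0 := QD.even_le hu hr hR hg0 256 (by norm_num) (fun m => by
    simp only [QD.L, mul_add, pow_add]; ring)
  have b1 := QD.even_le hu hr hR hg1 256 (by norm_num) (fun m => by
    simp only [QD.L, mul_add, pow_add]; ring)
  have bid := QD.le_id hu hr hR hR2
  refine ⟨QD.P u R id, QD.P_prob u R hR1 strictMono_id,
    ⟨closedBall 0 1, isCompact_closedBall _ _, QD.P_ball hu R id⟩, ?_⟩
  apply ne_of_gt
  refine lt_of_le_of_lt ?_ (lt_of_lt_of_le (by norm_num : (2:ℝ) / (256 : ℕ) < 1 / 80) bid)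
  set S := {d : ℝ | _}
  by_cases hS : BddBelow S
  swap
  · rw [Real.sInf_of_not_bddBelow hS]; positivity
  have t0 := QD.M_univ_ne_zero u R id
  have t1 := QD.M_univ_ne_top u R hR1 strictMono_id
  have m00 := QD.M_univ_ne_zero u R (fun j => 2 * j)
  have m01 := QD.M_univ_ne_top u R hR1 hg0
  have m10 := QD.M_univ_ne_zero u R (fun j => 2 * j + 1)
  have m11 := QD.M_univ_ne_top u R hR1 hg1
  let T := QD.M u R id Set.univ
  let A := QD.M u R (fun j => 2 * j) Set.univ
  let B := QD.M u R (fun j => 2 * j + 1) Set.univ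
  have hA : T⁻¹ * A ≠ ⊤ := ENNReal.mul_ne_top (by simpa [T] using t0) m01
  have hB : T⁻¹ * B ≠ ⊤ := ENNReal.mul_ne_top (by simpa [T] using t0) m11
  refine (csInf_le hS (a := ⨆ i : Fin 2, lowerQuantDim
    ((![QD.P u R (fun j => 2 * j), QD.P u R (fun j => 2 * j + 1)] :
      Fin 2 → Measure (EuclideanSpace ℝ (Fin q))) i) r) ?_).trans ?_
  · refine ⟨2, by norm_num, ![(T⁻¹ * A).toReal, (T⁻¹ * B).toReal], _, ?_, ?_, ?_, ?_, rfl⟩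
    · intro i
      fin_cases i
      · exact ENNReal.toReal_pos (mul_ne_zero (by simpa [T] using t1) m00) hA
      · exact ENNReal.toReal_pos (mul_ne_zero (by simpa [T] using t1) m10) hB
    · intro i
      fin_cases i
      · exact i0
      · exact i1
    · intro i
      refine ⟨closedBall 0 1, isCompact_closedBall _ _, ?_⟩
      fin_cases i
      · exact QD.P_ball hu R _
      · exact QD.P_ball hu R _
    · simp only [Fin.sum_univ_two, Matrix.cons_val_zero, Matrix.cons_val_one]
      rw [ENNReal.ofReal_toReal hA, ENNReal.ofReal_toReal hB, ← smul_smul, ← smul_smul,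
        ← QD.smul_P u R hR1 hg0, ← QD.smul_P u R hR1 hg1, ← smul_add, ← QD.M_split]
      rfl
  · refine ciSup_le fun i => ?_
    fin_cases i
    · exact b0
    · exact b1
end
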